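/- arXiv:1403.7312 — 3 statements merged into one kernel-verified Lean document; each statement's English description precedes it below -/
import Mathlib

section
/- Let A and B be separable C*-algebras, and let φ₀ : A → B and ψ₀ : B → A be *-homomorphisms such that ψ₀ ∘ φ₀ is approximately unitarily equivalent to the identity on A and φ₀ ∘ ψ₀ is approximately unitarily equivalent to the identity on B. Then there exists a *-isomorphism φ : A → B such that φ is approximately unitarily equivalent to φ₀ and φ⁻¹ is approximately unitarily equivalent to ψ₀. -/
open Filter Topology

/-- Two maps `f g : A → B` into a (possibly non-unital) C⋆-algebra `B` are approximately
unitarily equivalent if there is a sequence of unitaries in the minimal unitalization of `B`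
conjugating `f` to `g` pointwise in norm. -/
def ApproxUnitarilyEquiv {A B : Type*} [NonUnitalCStarAlgebra B] (f g : A → B) : Prop :=
  ∃ u : ℕ → unitary (Unitization ℂ B), ∀ a : A,
    Tendsto
      (fun n => ‖(u n : Unitization ℂ B) * (f a : Unitization ℂ B) * star (u n : Unitization ℂ B)
        - (g a : Unitization ℂ B)‖) atTop (𝓝 0)

theorem cauchySeq_of_dist_le_geometric_two {X : Type*} [PseudoMetricSpace X] {u : ℕ → X} {k : ℕ}
    (hu : ∀ n, k ≤ n → dist (u (n + 1)) (u (n + 2)) ≤ 2 * (1 / 2 : ℝ) ^ n) : CauchySeq u := by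
  refine (cauchySeq_shift (k + 1)).1 (cauchySeq_of_le_geometric (1 / 2) 2 (by norm_num) fun n => ?_)
  calc dist (u (n + (k + 1))) (u (n + 1 + (k + 1)))
      ≤ 2 * (1 / 2 : ℝ) ^ (n + k) := by
        have := hu (n + k) (by omega)
        rwa [show n + 1 + (k + 1) = n + k + 2 by ring]
    _ ≤ 2 * (1 / 2 : ℝ) ^ n := by
        gcongr 2 * ?_
        exact pow_le_pow_of_le_one (by norm_num) (by norm_num) (by omega)

theorem exists_tendsto_of_cauchySeq_denseRange {ι X Y : Type*} [PseudoMetricSpace X]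
    [PseudoMetricSpace Y] [CompleteSpace Y] {p : ι → X} (hp : DenseRange p) {f : ℕ → X → Y}
    (hf : ∀ n, LipschitzWith 1 (f n)) (hc : ∀ i, CauchySeq fun n => f n (p i)) :
    ∃ f' : X → Y, ∀ x, Tendsto (fun n => f n x) atTop (𝓝 (f' x)) := by
  suffices h : ∀ x, CauchySeq fun n => f n x by
    choose f' hf' using fun x => cauchySeq_tendsto_of_complete (h x)
    exact ⟨f', hf'⟩
  intro x
  rw [Metric.cauchySeq_iff']
  intro ε hε
  obtain ⟨i, hi⟩ := hp.exists_dist_lt x (show 0 < ε / 3 by positivity)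
  obtain ⟨N, hN⟩ := Metric.cauchySeq_iff'.1 (hc i) (ε / 3) (by positivity)
  refine ⟨N, fun n hn => ?_⟩
  have h₁ := (hf n).dist_le_mul x (p i)
  have h₂ := (hf N).dist_le_mul x (p i)
  have h₃ := dist_triangle4_right (f n x) (f N x) (f n (p i)) (f N (p i))
  simp only [NNReal.coe_one, one_mul] at h₁ h₂
  linarith [hN n hn]

theorem lipschitzWith_one_of_tendsto {X Y : Type*} [PseudoMetricSpace X] [PseudoMetricSpace Y]
    {f : ℕ → X → Y} {f' : X → Y} (hf : ∀ n, LipschitzWith 1 (f n))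
    (hf' : ∀ x, Tendsto (fun n => f n x) atTop (𝓝 (f' x))) : LipschitzWith 1 f' :=
  LipschitzWith.of_dist_le_mul fun x y =>
    le_of_tendsto ((hf' x).dist (hf' y)) (.of_forall fun n => (hf n).dist_le_mul x y)

theorem tendsto_apply_of_lipschitzWith_one {X Y : Type*} [PseudoMetricSpace X]
    [PseudoMetricSpace Y] {f : ℕ → X → Y} {f' : X → Y} (hf : ∀ n, LipschitzWith 1 (f n))
    (hf' : ∀ x, Tendsto (fun n => f n x) atTop (𝓝 (f' x))) {u : ℕ → X} {x : X}
    (hu : Tendsto u atTop (𝓝 x)) : Tendsto (fun n => f n (u n)) atTop (𝓝 (f' x)) := by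
  rw [tendsto_iff_dist_tendsto_zero] at hu ⊢
  have h := hu.add (tendsto_iff_dist_tendsto_zero.1 (hf' x))
  rw [add_zero] at h
  refine squeeze_zero (fun _ => dist_nonneg) (fun n => ?_) h
  have h₁ := (hf n).dist_le_mul (u n) x
  rw [NNReal.coe_one, one_mul] at h₁
  exact (dist_triangle _ (f n x) _).trans (by gcongr)

/-- Two-sided approximate intertwining: if `Φ` and `Ψ` are families of contractions between complete
separable metric spaces such that every member of one family is almost inverted, on finite sets,
by a member of the other family, then some sequences in `Φ` and `Ψ` converge pointwise to
mutually inverse maps. -/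
theorem exists_tendsto_inverse_of_almost_inverse {X Y : Type*} [MetricSpace X] [MetricSpace Y]
    [CompleteSpace X] [CompleteSpace Y] [TopologicalSpace.SeparableSpace X]
    [TopologicalSpace.SeparableSpace Y] [Nonempty X] [Nonempty Y]
    {Φ : Set (X → Y)} {Ψ : Set (Y → X)} (hΦ : Φ.Nonempty)
    (hΦL : ∀ f ∈ Φ, LipschitzWith 1 f) (hΨL : ∀ g ∈ Ψ, LipschitzWith 1 g)
    (hΦΨ : ∀ f ∈ Φ, ∀ F : Set X, F.Finite → ∀ ε > 0, ∃ g ∈ Ψ, ∀ x ∈ F, dist (g (f x)) x < ε)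
    (hΨΦ : ∀ g ∈ Ψ, ∀ G : Set Y, G.Finite → ∀ ε > 0, ∃ f ∈ Φ, ∀ y ∈ G, dist (f (g y)) y < ε) :
    ∃ (f : ℕ → X → Y) (g : ℕ → Y → X) (f' : X → Y) (g' : Y → X),
      (∀ n, f n ∈ Φ) ∧ (∀ n, g n ∈ Ψ) ∧
      (∀ x, Tendsto (fun n => f n x) atTop (𝓝 (f' x))) ∧
      (∀ y, Tendsto (fun n => g n y) atTop (𝓝 (g' y))) ∧
      Function.LeftInverse g' f' ∧ Function.RightInverse g' f' := by
  let p := TopologicalSpace.denseSeq X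
  let q := TopologicalSpace.denseSeq Y
  have hstep : ∀ (n : ℕ) (s : Φ × Ψ), ∃ t : Φ × Ψ, ∀ k ≤ n,
      (dist (t.1.1 (s.2.1 (q k))) (q k) < (1 / 2 : ℝ) ^ n ∧
        dist (t.1.1 (s.2.1 (s.1.1 (p k)))) (s.1.1 (p k)) < (1 / 2 : ℝ) ^ n) ∧
      dist (t.2.1 (t.1.1 (p k))) (p k) < (1 / 2 : ℝ) ^ n ∧
        dist (t.2.1 (t.1.1 (s.2.1 (q k)))) (s.2.1 (q k)) < (1 / 2 : ℝ) ^ n := by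
    rintro n ⟨⟨f, hf⟩, ⟨g, hg⟩⟩
    have hε : (0 : ℝ) < (1 / 2) ^ n := by positivity
    obtain ⟨f₁, hf₁, h₁⟩ := hΨΦ g hg (q '' Set.Iic n ∪ (fun k => f (p k)) '' Set.Iic n)
      (((Set.finite_Iic n).image _).union ((Set.finite_Iic n).image _)) _ hε
    obtain ⟨g₁, hg₁, h₂⟩ := hΦΨ f₁ hf₁ (p '' Set.Iic n ∪ (fun k => g (q k)) '' Set.Iic n)
      (((Set.finite_Iic n).image _).union ((Set.finite_Iic n).image _)) _ hε
    exact ⟨(⟨f₁, hf₁⟩, ⟨g₁, hg₁⟩), fun k hk =>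
      ⟨⟨h₁ _ (.inl ⟨k, hk, rfl⟩), h₁ _ (.inr ⟨k, hk, rfl⟩)⟩,
        h₂ _ (.inl ⟨k, hk, rfl⟩), h₂ _ (.inr ⟨k, hk, rfl⟩)⟩⟩
  choose next hnext using hstep
  obtain ⟨f₀, hf₀⟩ := hΦ
  obtain ⟨g₀, hg₀, -⟩ := hΦΨ f₀ hf₀ ∅ Set.finite_empty 1 one_pos
  let s : ℕ → Φ × Ψ := fun n => Nat.rec (⟨f₀, hf₀⟩, ⟨g₀, hg₀⟩) next n
  let f : ℕ → X → Y := fun n => (s n).1.1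
  let g : ℕ → Y → X := fun n => (s n).2.1
  have hf : ∀ n, f n ∈ Φ := fun n => (s n).1.2
  have hg : ∀ n, g n ∈ Ψ := fun n => (s n).2.2
  have hs : ∀ n, ∀ k ≤ n,
      (dist (f (n + 1) (g n (q k))) (q k) < (1 / 2 : ℝ) ^ n ∧
        dist (f (n + 1) (g n (f n (p k)))) (f n (p k)) < (1 / 2 : ℝ) ^ n) ∧
      dist (g (n + 1) (f (n + 1) (p k))) (p k) < (1 / 2 : ℝ) ^ n ∧
        dist (g (n + 1) (f (n + 1) (g n (q k)))) (g n (q k)) < (1 / 2 : ℝ) ^ n :=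
    fun n => hnext n (s n)
  have hpow : Tendsto (fun n : ℕ => (1 / 2 : ℝ) ^ n) atTop (𝓝 0) :=
    tendsto_pow_atTop_nhds_zero_of_lt_one (by norm_num) (by norm_num)
  have hpf : ∀ k n, k ≤ n → dist (f (n + 1) (p k)) (f (n + 2) (p k)) ≤ 2 * (1 / 2 : ℝ) ^ n := by
    intro k n hk
    have h₁ := (hs (n + 1) k (by omega)).1.2
    have h₂ := (hs n k hk).2.1
    have h₃ := (hΦL _ (hf (n + 2))).dist_le_mul (g (n + 1) (f (n + 1) (p k))) (p k)
    have h₄ := dist_triangle_left (f (n + 1) (p k)) (f (n + 2) (p k))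
      (f (n + 2) (g (n + 1) (f (n + 1) (p k))))
    rw [pow_succ] at h₁
    have : (0 : ℝ) < (1 / 2) ^ n := by positivity
    simp only [NNReal.coe_one, one_mul] at h₃
    linarith
  have hqg : ∀ k n, k ≤ n → dist (g (n + 1) (q k)) (g (n + 2) (q k)) ≤ 2 * (1 / 2 : ℝ) ^ n := by
    intro k n hk
    have h₁ := (hs (n + 1) k (by omega)).1.1
    have h₂ := (hs (n + 1) k (by omega)).2.2
    have h₃ := (hΨL _ (hg (n + 2))).dist_le_mul (f (n + 2) (g (n + 1) (q k))) (q k)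
    have h₄ := dist_triangle_left (g (n + 1) (q k)) (g (n + 2) (q k))
      (g (n + 2) (f (n + 2) (g (n + 1) (q k))))
    rw [pow_succ] at h₁ h₂
    have : (0 : ℝ) < (1 / 2) ^ n := by positivity
    simp only [NNReal.coe_one, one_mul] at h₃
    linarith
  obtain ⟨f', hf'⟩ := exists_tendsto_of_cauchySeq_denseRange (TopologicalSpace.denseRange_denseSeq X)
    (fun n => hΦL _ (hf n)) fun k => cauchySeq_of_dist_le_geometric_two (hpf k)
  obtain ⟨g', hg'⟩ := exists_tendsto_of_cauchySeq_denseRange (TopologicalSpace.denseRange_denseSeq Y)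
    (fun n => hΨL _ (hg n)) fun k => cauchySeq_of_dist_le_geometric_two (hqg k)
  have hf'c : Continuous f' := (lipschitzWith_one_of_tendsto (fun n => hΦL _ (hf n)) hf').continuous
  have hg'c : Continuous g' := (lipschitzWith_one_of_tendsto (fun n => hΨL _ (hg n)) hg').continuous
  refine ⟨f, g, f', g', hf, hg, hf', hg', ?_, ?_⟩
  · refine congrFun ((TopologicalSpace.denseRange_denseSeq X).equalizer (hg'c.comp hf'c)
      continuous_id (funext fun k => ?_))
    have h₁ := tendsto_apply_of_lipschitzWith_one (fun n => hΨL _ (hg n)) hg' (hf' (p k))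
    refine tendsto_nhds_unique ((tendsto_add_atTop_iff_nat 1).2 h₁) ?_
    rw [tendsto_iff_dist_tendsto_zero]
    exact squeeze_zero' (.of_forall fun _ => dist_nonneg)
      ((eventually_ge_atTop k).mono fun n hn => (hs n k hn).2.1.le) hpow
  · refine congrFun ((TopologicalSpace.denseRange_denseSeq Y).equalizer (hf'c.comp hg'c)
      continuous_id (funext fun k => ?_))
    have h₁ := tendsto_apply_of_lipschitzWith_one (fun n => hΦL _ (hf (n + 1)))
      (fun x => (tendsto_add_atTop_iff_nat 1).2 (hf' x)) (hg' (q k))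
    refine tendsto_nhds_unique h₁ ?_
    rw [tendsto_iff_dist_tendsto_zero]
    exact squeeze_zero' (.of_forall fun _ => dist_nonneg)
      ((eventually_ge_atTop k).mono fun n hn => (hs n k hn).1.1.le) hpow

/-- Conjugation by a unitary of the minimal unitalization, as a ⋆-endomorphism of the algebra. -/
def unitizationConj {B : Type*} [NonUnitalCStarAlgebra B] (u : unitary (Unitization ℂ B)) :
    B →⋆ₙₐ[ℂ] B where
  toFun b := (Unitary.conjStarAlgAut ℂ _ u (b : Unitization ℂ B)).snd
  map_smul' c b := by simp only [Unitization.inr_smul, map_smul, Unitization.snd_smul]; rfl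
  map_zero' := by simp
  map_add' a b := by simp only [Unitization.inr_add, map_add, Unitization.snd_add]
  map_mul' a b := by
    have h : ∀ b : B, (Unitary.conjStarAlgAut ℂ _ u (b : Unitization ℂ B)).fst = 0 := by simp
    simp only [Unitization.inr_mul, map_mul, Unitization.snd_mul, h, zero_smul, zero_add]
  map_star' b := by simp only [Unitization.inr_star, map_star, Unitization.snd_star]

theorem inr_unitizationConj {B : Type*} [NonUnitalCStarAlgebra B] (u : unitary (Unitization ℂ B))
    (b : B) : (unitizationConj u b : Unitization ℂ B) =
      (u : Unitization ℂ B) * (b : Unitization ℂ B) * star (u : Unitization ℂ B) :=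
  Unitization.ext (by simp) rfl

theorem unitizationConj_mul {B : Type*} [NonUnitalCStarAlgebra B]
    (u v : unitary (Unitization ℂ B)) (b : B) :
    unitizationConj (u * v) b = unitizationConj u (unitizationConj v b) :=
  Unitization.inr_injective (R := ℂ) (by simp [inr_unitizationConj, mul_assoc])

theorem unitizationConj_star_apply {B : Type*} [NonUnitalCStarAlgebra B]
    (u : unitary (Unitization ℂ B)) (b : B) :
    unitizationConj (star u) (unitizationConj u b) = b := by
  rw [← unitizationConj_mul, Unitary.star_mul_self]
  exact Unitization.inr_injective (R := ℂ) (by simp [inr_unitizationConj])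

theorem lipschitzWith_nonUnitalStarAlgHom {A B : Type*} [NonUnitalCStarAlgebra A]
    [NonUnitalCStarAlgebra B] (φ : A →⋆ₙₐ[ℂ] B) : LipschitzWith 1 φ :=
  LipschitzWith.of_dist_le_mul fun a b => by
    simpa [dist_eq_norm, ← map_sub] using NonUnitalStarAlgHom.norm_apply_le φ (a - b)

theorem approxUnitarilyEquiv_iff {A B : Type*} [NonUnitalCStarAlgebra B] {f g : A → B} :
    ApproxUnitarilyEquiv f g ↔ ∃ u : ℕ → unitary (Unitization ℂ B),
      ∀ a, Tendsto (fun n => unitizationConj (u n) (f a)) atTop (𝓝 (g a)) := by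
  simp only [ApproxUnitarilyEquiv, ← inr_unitizationConj, ← Unitization.inr_sub,
    Unitization.norm_inr, ← tendsto_iff_norm_sub_tendsto_zero]

/-- A pointwise limit of unitary conjugates of `g` is approximately unitarily equivalent to `g`. -/
theorem approxUnitarilyEquiv_of_tendsto {A B : Type*} [NonUnitalCStarAlgebra B] {f g : A → B}
    {u : ℕ → unitary (Unitization ℂ B)}
    (h : ∀ a, Tendsto (fun n => unitizationConj (u n) (g a)) atTop (𝓝 (f a))) :
    ApproxUnitarilyEquiv f g := by
  refine approxUnitarilyEquiv_iff.2 ⟨fun n => star (u n), fun a => ?_⟩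
  rw [tendsto_iff_dist_tendsto_zero]
  refine squeeze_zero (fun _ => dist_nonneg) (fun n => ?_)
    (tendsto_iff_dist_tendsto_zero.1 (h a))
  have := (lipschitzWith_nonUnitalStarAlgHom (unitizationConj (star (u n)))).dist_le_mul
    (f a) (unitizationConj (u n) (g a))
  rwa [unitizationConj_star_apply, NNReal.coe_one, one_mul, dist_comm (f a)] at this

/-- A pointwise limit of ⋆-homomorphisms is a ⋆-homomorphism. -/
theorem exists_nonUnitalStarAlgHom_of_tendsto {A B : Type*} [NonUnitalCStarAlgebra A]
    [NonUnitalCStarAlgebra B] {φ : ℕ → A →⋆ₙₐ[ℂ] B} {f : A → B}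
    (h : ∀ a, Tendsto (fun n => φ n a) atTop (𝓝 (f a))) : ∃ φ' : A →⋆ₙₐ[ℂ] B, ⇑φ' = f :=
  ⟨{  toFun := f
      map_smul' c a := tendsto_nhds_unique (h (c • a)) (by simpa using (h a).const_smul c)
      map_zero' := tendsto_nhds_unique (h 0) (by simp)
      map_add' a b := tendsto_nhds_unique (h (a + b)) (by simpa using (h a).add (h b))
      map_mul' a b := tendsto_nhds_unique (h (a * b)) (by simpa using (h a).mul (h b))
      map_star' a := tendsto_nhds_unique (h (star a)) (by simpa [map_star] using (h a).star) },
    rfl⟩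

/-- If `ψ ∘ φ ≈ᵤ id`, then every unitary conjugate of `φ` is inverted on the left, up to any
`ε > 0` and on any finite set, by some unitary conjugate of `ψ`. -/
theorem ApproxUnitarilyEquiv.exists_conj_almost_leftInverse {A B : Type*}
    [NonUnitalCStarAlgebra A] [NonUnitalCStarAlgebra B] {φ : A →⋆ₙₐ[ℂ] B} {ψ : B →⋆ₙₐ[ℂ] A}
    (h : ApproxUnitarilyEquiv (fun a => ψ (φ a)) (id : A → A)) (v : unitary (Unitization ℂ B))
    {F : Set A} (hF : F.Finite) {ε : ℝ} (hε : 0 < ε) :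
    ∃ u, ∀ a ∈ F, dist (unitizationConj u (ψ (unitizationConj v (φ a)))) a < ε := by
  obtain ⟨w, hw⟩ := approxUnitarilyEquiv_iff.1 h
  obtain ⟨n, hn⟩ := ((eventually_all_finite hF).2 fun a _ =>
    Metric.tendsto_nhds.1 (hw a) ε hε).exists
  let v' : unitary (Unitization ℂ A) := ⟨Unitization.starMap ψ v, Unitary.map_mem _ v.2⟩
  have hψ : ∀ b, ψ (unitizationConj v b) = unitizationConj v' (ψ b) := fun b => by
    refine Unitization.inr_injective (R := ℂ) ?_
    rw [← Unitization.starMap_inr, inr_unitizationConj, inr_unitizationConj, map_mul, map_mul,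
      map_star, Unitization.starMap_inr]
  refine ⟨w n * star v', fun a ha => ?_⟩
  rw [unitizationConj_mul, hψ, unitizationConj_star_apply]
  exact hn a ha


/-- If `ψ₀ ∘ φ₀ ≈ᵤ id` and `φ₀ ∘ ψ₀ ≈ᵤ id` for ⋆-homomorphisms between separable C⋆-algebras,
then there is a ⋆-isomorphism `φ : A ≃ B` with `φ ≈ᵤ φ₀` and `φ⁻¹ ≈ᵤ ψ₀`. -/
theorem approxUnitarilyEquiv_intertwining
    {A B : Type*} [NonUnitalCStarAlgebra A] [NonUnitalCStarAlgebra B]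
    [TopologicalSpace.SeparableSpace A] [TopologicalSpace.SeparableSpace B]
    (φ₀ : A →⋆ₙₐ[ℂ] B) (ψ₀ : B →⋆ₙₐ[ℂ] A)
    (h₁ : ApproxUnitarilyEquiv (fun a => ψ₀ (φ₀ a)) (id : A → A))
    (h₂ : ApproxUnitarilyEquiv (fun b => φ₀ (ψ₀ b)) (id : B → B)) :
    ∃ φ : A ≃⋆ₐ[ℂ] B,
      ApproxUnitarilyEquiv (⇑φ) (⇑φ₀) ∧ ApproxUnitarilyEquiv (⇑φ.symm) (⇑ψ₀) := by
  obtain ⟨f, g, f', g', hf, hg, hf', hg', hl, hr⟩ := exists_tendsto_inverse_of_almost_inverse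
    (Φ := Set.range fun v => unitizationConj v ∘ φ₀)
    (Ψ := Set.range fun u => unitizationConj u ∘ ψ₀) ⟨_, 1, rfl⟩
    (by
      rintro _ ⟨v, rfl⟩
      exact lipschitzWith_nonUnitalStarAlgHom ((unitizationConj v).comp φ₀))
    (by
      rintro _ ⟨u, rfl⟩
      exact lipschitzWith_nonUnitalStarAlgHom ((unitizationConj u).comp ψ₀))
    (by
      rintro _ ⟨v, rfl⟩ F hF ε hε
      obtain ⟨u, hu⟩ := h₁.exists_conj_almost_leftInverse v hF hε
      exact ⟨_, ⟨u, rfl⟩, hu⟩)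
    (by
      rintro _ ⟨u, rfl⟩ G hG ε hε
      obtain ⟨v, hv⟩ := h₂.exists_conj_almost_leftInverse u hG hε
      exact ⟨_, ⟨v, rfl⟩, hv⟩)
  choose v hv using hf
  choose u hu using hg
  replace hf' : ∀ a, Tendsto (fun n => unitizationConj (v n) (φ₀ a)) atTop (𝓝 (f' a)) :=
    fun a => by simpa [← hv] using hf' a
  replace hg' : ∀ b, Tendsto (fun n => unitizationConj (u n) (ψ₀ b)) atTop (𝓝 (g' b)) :=
    fun b => by simpa [← hu] using hg' b
  obtain ⟨φ, rfl⟩ :=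
    exists_nonUnitalStarAlgHom_of_tendsto (φ := fun n => (unitizationConj (v n)).comp φ₀) hf'
  exact ⟨{  toFun := φ
            invFun := g'
            left_inv := hl
            right_inv := hr
            map_mul' := map_mul φ
            map_add' := map_add φ
            map_star' := map_star φ
            map_smul' := map_smul φ },
    approxUnitarilyEquiv_of_tendsto hf', approxUnitarilyEquiv_of_tendsto hg'⟩
end

section
/- Let A and B be separable C*-algebras, and let φ₀ : A → B and ψ₀ : B → A be *-homomorphisms such that ψ₀ ∘ φ₀ is approximately multiplier unitarily equivalent to the identity on A and φ₀ ∘ ψ₀ is approximately multiplier unitarily equivalent to the identity on B. Then there exists a *-isomorphism φ : A → B such that φ is approximately multiplier unitarily equivalent to φ₀ and φ⁻¹ is approximately multiplier unitarily equivalent to ψ₀. -/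
open Filter Topology
open scoped MultiplierAlgebra

/-- Two maps `f g : A → B` into a (possibly non-unital) C⋆-algebra `B` are approximately
multiplier unitarily equivalent if there is a sequence of unitaries in the multiplier algebra
`𝓜(ℂ, B)` conjugating `f` to `g` pointwise in norm. -/
def ApproxMultiplierUnitarilyEquiv {A B : Type*} [NonUnitalCStarAlgebra B] (f g : A → B) : Prop :=
  ∃ u : ℕ → unitary 𝓜(ℂ, B), ∀ a : A,
    Tendsto
      (fun n => ‖(u n : 𝓜(ℂ, B)) * (f a : 𝓜(ℂ, B)) * star (u n : 𝓜(ℂ, B))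
        - (g a : 𝓜(ℂ, B))‖) atTop (𝓝 0)

namespace DoubleCentralizer

variable {A B : Type*} [NonUnitalCStarAlgebra A] [NonUnitalCStarAlgebra B]

theorem fst_mul (m : 𝓜(ℂ, A)) (x y : A) : m.fst (x * y) = m.fst x * y := by
  rw [← sub_eq_zero, ← CStarRing.star_mul_self_eq_zero_iff, mul_sub, sub_eq_zero,
    ← m.central, ← mul_assoc _ (m.fst x), ← m.central, mul_assoc]

theorem snd_mul (m : 𝓜(ℂ, A)) (x y : A) : m.snd (x * y) = x * m.snd y := by
  rw [← sub_eq_zero, ← CStarRing.mul_star_self_eq_zero_iff, sub_mul, sub_eq_zero,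
    m.central, mul_assoc x (m.snd y), m.central, mul_assoc]

theorem fst_snd (m n : 𝓜(ℂ, A)) (x : A) : m.fst (n.snd x) = n.snd (m.fst x) := by
  rw [← sub_eq_zero, ← CStarRing.star_mul_self_eq_zero_iff, mul_sub, sub_eq_zero,
    ← m.central, ← snd_mul, ← snd_mul, m.central]

theorem coe_fst_apply (m : 𝓜(ℂ, A)) (x : A) :
    ((m.fst x : A) : 𝓜(ℂ, A)) = m * (x : 𝓜(ℂ, A)) := by
  ext y
  · simp [fst_mul]
  · simp [m.central]

theorem coe_snd_apply (m : 𝓜(ℂ, A)) (x : A) :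
    ((m.snd x : A) : 𝓜(ℂ, A)) = (x : 𝓜(ℂ, A)) * m := by
  ext y
  · simp [m.central]
  · simp [snd_mul]

theorem coe_injective : Function.Injective (DoubleCentralizer.coe ℂ : A → 𝓜(ℂ, A)) := by
  refine (injective_iff_map_eq_zero (coeHom (𝕜 := ℂ) (A := A))).2 fun x hx => ?_
  rw [← CStarRing.mul_star_self_eq_zero_iff]
  exact congrArg (fun m : 𝓜(ℂ, A) => m.fst (star x)) hx

theorem coe_mul (x y : A) : ((x * y : A) : 𝓜(ℂ, A)) = (x : 𝓜(ℂ, A)) * (y : 𝓜(ℂ, A)) :=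
  map_mul (coeHom (𝕜 := ℂ) (A := A)) x y

theorem norm_coe_sub_coe (x y : A) : ‖(x : 𝓜(ℂ, A)) - (y : 𝓜(ℂ, A))‖ = ‖x - y‖ := by
  rw [← NonUnitalStarAlgHom.norm_map (coeHom (𝕜 := ℂ) (A := A)) coe_injective, map_sub]
  rfl

/-- A ⋆-isomorphism as a continuous linear map. -/
def _root_.StarAlgEquiv.toContinuousLinearMap (Φ : A ≃⋆ₐ[ℂ] B) : A →L[ℂ] B where
  toFun := Φ
  map_add' := map_add Φ
  map_smul' := map_smul Φ
  cont := (NonUnitalStarAlgHom.isometry Φ Φ.injective).continuous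

@[simp]
theorem _root_.StarAlgEquiv.toContinuousLinearMap_apply (Φ : A ≃⋆ₐ[ℂ] B) (x : A) :
    Φ.toContinuousLinearMap x = Φ x := rfl

/-- The map of multiplier algebras induced by a ⋆-isomorphism. -/
noncomputable def map (Φ : A ≃⋆ₐ[ℂ] B) (m : 𝓜(ℂ, A)) : 𝓜(ℂ, B) where
  fst := Φ.toContinuousLinearMap.comp (m.fst.comp Φ.symm.toContinuousLinearMap)
  snd := Φ.toContinuousLinearMap.comp (m.snd.comp Φ.symm.toContinuousLinearMap)
  central x y := by simpa using congrArg Φ (m.central (Φ.symm x) (Φ.symm y))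

@[simp]
theorem map_fst_apply (Φ : A ≃⋆ₐ[ℂ] B) (m : 𝓜(ℂ, A)) (x : B) :
    (map Φ m).fst x = Φ (m.fst (Φ.symm x)) := rfl

@[simp]
theorem map_snd_apply (Φ : A ≃⋆ₐ[ℂ] B) (m : 𝓜(ℂ, A)) (x : B) :
    (map Φ m).snd x = Φ (m.snd (Φ.symm x)) := rfl

theorem map_mul (Φ : A ≃⋆ₐ[ℂ] B) (m n : 𝓜(ℂ, A)) : map Φ (m * n) = map Φ m * map Φ n := by
  ext <;> simp

theorem map_one (Φ : A ≃⋆ₐ[ℂ] B) : map Φ (1 : 𝓜(ℂ, A)) = 1 := by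
  ext <;> simp

theorem map_star (Φ : A ≃⋆ₐ[ℂ] B) (m : 𝓜(ℂ, A)) : map Φ (star m) = star (map Φ m) := by
  ext <;> simp [StarHomClass.map_star]

theorem map_coe (Φ : A ≃⋆ₐ[ℂ] B) (x : A) :
    map Φ (x : 𝓜(ℂ, A)) = ((Φ x : B) : 𝓜(ℂ, B)) := by
  ext <;> simp

theorem map_mem_unitary (Φ : A ≃⋆ₐ[ℂ] B) (u : unitary 𝓜(ℂ, A)) :
    map Φ u ∈ unitary 𝓜(ℂ, B) := by
  rw [Unitary.mem_iff, ← map_star, ← map_mul, ← map_mul]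
  simp [map_one]

theorem unitary_star_mul_cancel (u : unitary 𝓜(ℂ, A)) (m : 𝓜(ℂ, A)) :
    star (u : 𝓜(ℂ, A)) * ((u : 𝓜(ℂ, A)) * m) = m := by
  rw [← mul_assoc, Unitary.coe_star_mul_self, one_mul]

theorem unitary_mul_star_cancel (u : unitary 𝓜(ℂ, A)) (m : 𝓜(ℂ, A)) :
    (u : 𝓜(ℂ, A)) * (star (u : 𝓜(ℂ, A)) * m) = m := by
  rw [← mul_assoc, Unitary.mul_star_self_of_mem u.2, one_mul]

variable (A) in
/-- The automorphisms of a C⋆-algebra implemented by unitaries in its multiplier algebra. -/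
def unitaryAut : Subgroup (A ≃⋆ₐ[ℂ] A) where
  carrier := {α | ∃ u : unitary 𝓜(ℂ, A), ∀ x : A,
    ((α x : A) : 𝓜(ℂ, A)) = (u : 𝓜(ℂ, A)) * (x : 𝓜(ℂ, A)) * star (u : 𝓜(ℂ, A))}
  mul_mem' := by
    rintro α β ⟨u, hu⟩ ⟨v, hv⟩
    exact ⟨u * v, fun x => by simp [hu, hv, mul_assoc]⟩
  one_mem' := ⟨1, fun x => by simp⟩
  inv_mem' := by
    rintro α ⟨u, hu⟩
    refine ⟨star u, fun x => ?_⟩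
    have h := hu (α.symm x)
    rw [StarAlgEquiv.apply_symm_apply] at h
    rw [h, StarAlgEquiv.aut_inv, Unitary.coe_star, star_star]
    simp only [mul_assoc, unitary_star_mul_cancel, Unitary.coe_star_mul_self, mul_one]

/-- Conjugation by a unitary of the multiplier algebra. -/
noncomputable def conjAut (u : unitary 𝓜(ℂ, A)) : A ≃⋆ₐ[ℂ] A where
  toFun x := (u : 𝓜(ℂ, A)).fst ((star (u : 𝓜(ℂ, A))).snd x)
  invFun x := (star (u : 𝓜(ℂ, A))).fst ((u : 𝓜(ℂ, A)).snd x)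
  left_inv x := coe_injective (by
    simp only [coe_fst_apply, coe_snd_apply, mul_assoc, unitary_star_mul_cancel,
      Unitary.coe_star_mul_self, mul_one])
  right_inv x := coe_injective (by
    simp only [coe_fst_apply, coe_snd_apply, mul_assoc, unitary_mul_star_cancel,
      Unitary.mul_star_self_of_mem u.2, mul_one])
  map_mul' x y := coe_injective (by
    simp only [coe_mul, coe_fst_apply, coe_snd_apply, mul_assoc, unitary_star_mul_cancel])
  map_add' x y := by simp
  map_star' x := by
    rw [fst_snd]
    simp
  map_smul' r x := by simp

theorem coe_conjAut_apply (u : unitary 𝓜(ℂ, A)) (x : A) :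
    ((conjAut u x : A) : 𝓜(ℂ, A))
      = (u : 𝓜(ℂ, A)) * (x : 𝓜(ℂ, A)) * star (u : 𝓜(ℂ, A)) := by
  rw [mul_assoc, ← coe_snd_apply, ← coe_fst_apply]
  rfl

theorem conjAut_mem_unitaryAut (u : unitary 𝓜(ℂ, A)) : conjAut u ∈ unitaryAut A :=
  ⟨u, coe_conjAut_apply u⟩

theorem conj_mem_unitaryAut (Φ : A ≃⋆ₐ[ℂ] B) {α : A ≃⋆ₐ[ℂ] A} (hα : α ∈ unitaryAut A) :
    (Φ.symm.trans α).trans Φ ∈ unitaryAut B := by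
  obtain ⟨u, hu⟩ := hα
  refine ⟨⟨map Φ u, map_mem_unitary Φ u⟩, fun x => ?_⟩
  rw [StarAlgEquiv.trans_apply, StarAlgEquiv.trans_apply, ← map_coe, hu, map_mul, map_mul,
    map_coe, map_star, StarAlgEquiv.apply_symm_apply]

end DoubleCentralizer

open DoubleCentralizer

theorem approxMultiplierUnitarilyEquiv_iff {A B : Type*} [NonUnitalCStarAlgebra B]
    {f g : A → B} :
    ApproxMultiplierUnitarilyEquiv f g ↔
      ∃ α : ℕ → (B ≃⋆ₐ[ℂ] B), (∀ n, α n ∈ unitaryAut B) ∧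
        ∀ a, Tendsto (fun n => α n (f a)) atTop (𝓝 (g a)) := by
  constructor
  · rintro ⟨u, hu⟩
    refine ⟨fun n => conjAut (u n), fun n => conjAut_mem_unitaryAut _, fun a => ?_⟩
    rw [tendsto_iff_norm_sub_tendsto_zero]
    simpa only [← coe_conjAut_apply, norm_coe_sub_coe] using hu a
  · rintro ⟨α, hα, h⟩
    choose u hu using hα
    refine ⟨u, fun a => ?_⟩
    simpa only [← hu, norm_coe_sub_coe] using tendsto_iff_norm_sub_tendsto_zero.1 (h a)

section Limits

variable {A B : Type*} [NonUnitalCStarAlgebra A] [NonUnitalCStarAlgebra B]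

theorem NonUnitalStarAlgHom.dist_apply_le (f : A →⋆ₙₐ[ℂ] B) (x y : A) :
    dist (f x) (f y) ≤ dist x y := by
  simpa only [dist_eq_norm, ← map_sub] using NonUnitalStarAlgHom.norm_apply_le f (x - y)

theorem NonUnitalStarAlgHom.lipschitzWith_one (f : A →⋆ₙₐ[ℂ] B) : LipschitzWith 1 f :=
  LipschitzWith.of_dist_le_mul fun x y => by simpa using f.dist_apply_le x y

/-- Pointwise convergence of ⋆-homomorphisms may be checked on a dense set. -/
theorem NonUnitalStarAlgHom.tendsto_of_dense {f : ℕ → A →⋆ₙₐ[ℂ] B} {g : A →⋆ₙₐ[ℂ] B}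
    {s : Set A} (hs : Dense s) (h : ∀ a ∈ s, Tendsto (fun n => f n a) atTop (𝓝 (g a))) (a : A) :
    Tendsto (fun n => f n a) atTop (𝓝 (g a)) := by
  have hF : Equicontinuous fun n => (f n : A → B) :=
    (LipschitzWith.uniformEquicontinuous _ 1 fun n => (f n).lipschitzWith_one).equicontinuous
  exact (hF.isClosed_setOfPred_tendsto g.lipschitzWith_one.continuous).closure_subset_iff.2 h
    (hs a)

/-- A pointwise limit of ⋆-homomorphisms is a ⋆-homomorphism. -/
noncomputable def NonUnitalStarAlgHom.ofTendsto (f : ℕ → A →⋆ₙₐ[ℂ] B) (g : A → B)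
    (h : ∀ a, Tendsto (fun n => f n a) atTop (𝓝 (g a))) : A →⋆ₙₐ[ℂ] B where
  toFun := g
  map_smul' c x := tendsto_nhds_unique (h (c • x)) (by simpa using (h x).const_smul c)
  map_zero' := tendsto_nhds_unique (h 0) (by simp)
  map_add' x y := tendsto_nhds_unique (h (x + y)) (by simpa using (h x).add (h y))
  map_mul' x y := tendsto_nhds_unique (h (x * y)) (by simpa using (h x).mul (h y))
  map_star' x := tendsto_nhds_unique (h (star x)) (by simpa [StarHomClass.map_star] using (h x).star)

/-- A sequence of ⋆-homomorphisms whose increments are summable on an increasing sequence of sets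
with dense union converges pointwise. -/
theorem NonUnitalStarAlgHom.exists_tendsto {f : ℕ → A →⋆ₙₐ[ℂ] B} {F : ℕ → Set A}
    (hF : Monotone F) (hd : Dense (⋃ n, F n))
    (h : ∀ n, ∀ a ∈ F n, dist (f n a) (f (n + 1) a) ≤ 2 / 2 ^ n) :
    ∃ g : A →⋆ₙₐ[ℂ] B, (∀ a, Tendsto (fun n => f n a) atTop (𝓝 (g a))) ∧
      ∀ n, ∀ a ∈ F n, dist (f n a) (g a) ≤ 4 / 2 ^ n := by
  have hshift (n : ℕ) (a : A) (ha : a ∈ F n) (k : ℕ) :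
      dist (f (n + k) a) (f (n + k + 1) a) ≤ 4 / 2 ^ n / 2 / 2 ^ k := by
    refine (h (n + k) a (hF (Nat.le_add_right n k) ha)).trans_eq ?_
    rw [pow_add]
    field_simp
    norm_num
  have hcauchy (a : A) : CauchySeq fun n => f n a := by
    rw [Metric.cauchySeq_iff']
    intro ε hε
    obtain ⟨b, hb, hab⟩ := hd.exists_dist_lt a (show 0 < ε / 3 by positivity)
    obtain ⟨n, hn⟩ := Set.mem_iUnion.1 hb
    obtain ⟨N, hN⟩ := Metric.cauchySeq_iff'.1
      (cauchySeq_of_le_geometric_two (hshift n b hn)) (ε / 3) (by positivity)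
    refine ⟨n + N, fun m hm => ?_⟩
    obtain ⟨k, rfl⟩ := Nat.exists_eq_add_of_le hm
    have h1 := (f (n + N + k)).dist_apply_le a b
    have h2 := (f (n + N)).dist_apply_le b a
    have h3 := hN (N + k) (Nat.le_add_right _ _)
    rw [← add_assoc] at h3
    rw [dist_comm b a] at h2
    have h4 := dist_triangle4 (f (n + N + k) a) (f (n + N + k) b) (f (n + N) b) (f (n + N) a)
    linarith
  choose g hg using fun a => cauchySeq_tendsto_of_complete (hcauchy a)
  refine ⟨.ofTendsto f g hg, hg, fun n a ha => ?_⟩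
  refine dist_le_of_le_geometric_two_of_tendsto₀ (f := fun k => f (n + k) a) (hshift n a ha) ?_
  simpa only [add_comm n] using! (tendsto_add_atTop_iff_nat n).2 (hg a)

/-- A two-sided approximate intertwining of C⋆-algebras induces a ⋆-isomorphism. -/
theorem exists_starAlgEquiv_of_approx_intertwining
    {φ : ℕ → A →⋆ₙₐ[ℂ] B} {ψ : ℕ → B →⋆ₙₐ[ℂ] A} {F : ℕ → Set A} {G : ℕ → Set B}
    (hF : Monotone F) (hG : Monotone G) (hFd : Dense (⋃ n, F n)) (hGd : Dense (⋃ n, G n))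
    (hφ : ∀ n, Set.MapsTo (φ n) (F n) (G n)) (hψ : ∀ n, Set.MapsTo (ψ n) (G n) (F (n + 1)))
    (hψφ : ∀ n, ∀ a ∈ F n, dist (ψ n (φ n a)) a ≤ 1 / 2 ^ n)
    (hφψ : ∀ n, ∀ b ∈ G n, dist (φ (n + 1) (ψ n b)) b ≤ 1 / 2 ^ n) :
    ∃ Φ : A ≃⋆ₐ[ℂ] B, (∀ n, ∀ a ∈ F n, dist (φ n a) (Φ a) ≤ 4 / 2 ^ n) ∧
      ∀ n, ∀ b ∈ G n, dist (ψ n b) (Φ.symm b) ≤ 4 / 2 ^ n := by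
  have hle (n : ℕ) : (1 : ℝ) / 2 ^ (n + 1) ≤ 1 / 2 ^ n :=
    one_div_pow_le_one_div_pow_of_le one_le_two n.le_succ
  have hzero (c : ℝ) : Tendsto (fun n : ℕ => c / 2 ^ n) atTop (𝓝 0) :=
    tendsto_const_nhds.div_atTop (tendsto_pow_atTop_atTop_of_one_lt one_lt_two)
  obtain ⟨f, hf, hf'⟩ := NonUnitalStarAlgHom.exists_tendsto (f := φ) hF hFd fun n a ha => by
    have h1 := hφψ n (φ n a) (hφ n ha)
    have h2 := (φ (n + 1)).dist_apply_le (ψ n (φ n a)) a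
    have h3 := dist_triangle_left (φ n a) (φ (n + 1) a) (φ (n + 1) (ψ n (φ n a)))
    linarith [hψφ n a ha, add_div (1 : ℝ) 1 (2 ^ n), one_add_one_eq_two (R := ℝ)]
  obtain ⟨g, hg, hg'⟩ := NonUnitalStarAlgHom.exists_tendsto (f := ψ) hG hGd fun n b hb => by
    have h1 := hψφ (n + 1) (ψ n b) (hψ n hb)
    have h2 := (ψ (n + 1)).dist_apply_le (φ (n + 1) (ψ n b)) b
    have h3 := dist_triangle_left (ψ n b) (ψ (n + 1) b) (ψ (n + 1) (φ (n + 1) (ψ n b)))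
    have h4 : (2 : ℝ) / 2 ^ n = 1 / 2 ^ n + 1 / 2 ^ n := by ring
    linarith [hφψ n b hb, hle n]
  have hgf (a : A) : g (f a) = a := by
    have h1 : Tendsto (fun n => ψ n (φ n a)) atTop (𝓝 a) := by
      refine NonUnitalStarAlgHom.tendsto_of_dense (f := fun n => (ψ n).comp (φ n))
        (g := NonUnitalStarAlgHom.id ℂ A) hFd (fun a ha => ?_) a
      obtain ⟨N, hN⟩ := Set.mem_iUnion.1 ha
      rw [tendsto_iff_dist_tendsto_zero]
      refine squeeze_zero' (.of_forall fun _ => dist_nonneg) ?_ (hzero 1)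
      filter_upwards [eventually_ge_atTop N] with n hn using hψφ n a (hF hn hN)
    have h2 : Tendsto (fun n => dist (ψ n (f a)) (ψ n (φ n a))) atTop (𝓝 0) := by
      refine squeeze_zero (fun _ => dist_nonneg) (fun n => (ψ n).dist_apply_le _ _) ?_
      simpa only [dist_comm] using tendsto_iff_dist_tendsto_zero.1 (hf a)
    exact tendsto_nhds_unique (hg (f a)) ((tendsto_iff_of_dist h2).2 h1)
  have hfg (b : B) : f (g b) = b := by
    have h1 : Tendsto (fun n => φ (n + 1) (ψ n b)) atTop (𝓝 b) := by
      refine NonUnitalStarAlgHom.tendsto_of_dense (f := fun n => (φ (n + 1)).comp (ψ n))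
        (g := NonUnitalStarAlgHom.id ℂ B) hGd (fun b hb => ?_) b
      obtain ⟨N, hN⟩ := Set.mem_iUnion.1 hb
      rw [tendsto_iff_dist_tendsto_zero]
      refine squeeze_zero' (.of_forall fun _ => dist_nonneg) ?_ (hzero 1)
      filter_upwards [eventually_ge_atTop N] with n hn using hφψ n b (hG hn hN)
    have h2 : Tendsto (fun n => dist (φ (n + 1) (g b)) (φ (n + 1) (ψ n b))) atTop (𝓝 0) := by
      refine squeeze_zero (fun _ => dist_nonneg) (fun n => (φ (n + 1)).dist_apply_le _ _) ?_
      simpa only [dist_comm] using tendsto_iff_dist_tendsto_zero.1 (hg b)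
    exact tendsto_nhds_unique ((tendsto_add_atTop_iff_nat 1).2 (hf (g b)))
      ((tendsto_iff_of_dist h2).2 h1)
  let Φ : A ≃⋆ₐ[ℂ] B := .ofBijective f
    ⟨Function.LeftInverse.injective hgf, Function.RightInverse.surjective hfg⟩
  refine ⟨Φ, hf', fun n b hb => ?_⟩
  have h : Φ.symm b = g b := by
    rw [← Φ.symm_apply_apply (g b)]
    exact congrArg Φ.symm (hfg b).symm
  rw [h]
  exact hg' n b hb

end Limits

section Intertwining

theorem ApproxMultiplierUnitarilyEquiv.exists_aut_dist_le
    {A B : Type*} [NonUnitalCStarAlgebra B] {f g : A → B}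
    (h : ApproxMultiplierUnitarilyEquiv f g) (F : Finset A) {ε : ℝ} (hε : 0 < ε) :
    ∃ α ∈ unitaryAut B, ∀ a ∈ F, dist (α (f a)) (g a) ≤ ε := by
  obtain ⟨α, hα, h⟩ := approxMultiplierUnitarilyEquiv_iff.1 h
  have : ∀ᶠ n in atTop, ∀ a ∈ F, dist (α n (f a)) (g a) ≤ ε :=
    F.eventually_all.2 fun a _ =>
      (Metric.tendsto_nhds.1 (h a) ε hε).mono fun _ hn => hn.le
  obtain ⟨n, hn⟩ := this.exists
  exact ⟨α n, hα n, hn⟩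

variable {A B : Type*} [NonUnitalCStarAlgebra A] [NonUnitalCStarAlgebra B]

/-- A ⋆-isomorphism which, up to automorphisms implemented by multiplier unitaries, is
approximated by a ⋆-homomorphism on a dense sequence is approximately multiplier unitarily
equivalent to it. -/
theorem approxMultiplierUnitarilyEquiv_of_dist_le (Φ : A ≃⋆ₐ[ℂ] B) (φ₀ : A →⋆ₙₐ[ℂ] B)
    {a : ℕ → A} (ha : DenseRange a) {α : ℕ → (A ≃⋆ₐ[ℂ] A)} {β : ℕ → (B ≃⋆ₐ[ℂ] B)}
    (hα : ∀ n, α n ∈ unitaryAut A) (hβ : ∀ n, β n ∈ unitaryAut B)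
    (h : ∀ n, ∀ k < n, dist (β n (φ₀ (a k))) (Φ (α n (a k))) ≤ 4 / 2 ^ n) :
    ApproxMultiplierUnitarilyEquiv Φ φ₀ := by
  refine approxMultiplierUnitarilyEquiv_iff.2
    ⟨fun n => (β n)⁻¹ * (Φ.symm.trans (α n)).trans Φ,
      fun n => mul_mem (inv_mem (hβ n)) (conj_mem_unitaryAut Φ (hα n)), fun x => ?_⟩
  refine NonUnitalStarAlgHom.tendsto_of_dense (g := φ₀)
    (f := fun n => (((β n)⁻¹ * (Φ.symm.trans (α n)).trans Φ : B ≃⋆ₐ[ℂ] B) : B →⋆ₙₐ[ℂ] B).comp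
      (Φ : A →⋆ₙₐ[ℂ] B)) ha ?_ x
  rintro _ ⟨k, rfl⟩
  rw [tendsto_iff_dist_tendsto_zero]
  refine squeeze_zero' (.of_forall fun _ => dist_nonneg) ?_
    (tendsto_const_nhds.div_atTop (tendsto_pow_atTop_atTop_of_one_lt (one_lt_two (α := ℝ))) :
      Tendsto (fun n : ℕ => (4 : ℝ) / 2 ^ n) atTop (𝓝 0))
  filter_upwards [eventually_gt_atTop k] with n hn
  refine le_trans ?_ (h n k hn)
  have h1 := NonUnitalStarAlgHom.dist_apply_le ((β n).symm : B →⋆ₙₐ[ℂ] B)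
    (Φ (α n (a k))) (β n (φ₀ (a k)))
  rw [dist_comm (β n _)]
  simpa [StarAlgEquiv.aut_inv] using h1

/-- The homomorphism `β ∘ φ₀ ∘ α⁻¹`. -/
def NonUnitalStarAlgHom.twist (φ₀ : A →⋆ₙₐ[ℂ] B) (α : A ≃⋆ₐ[ℂ] A) (β : B ≃⋆ₐ[ℂ] B) :
    A →⋆ₙₐ[ℂ] B :=
  (β : B →⋆ₙₐ[ℂ] B).comp (φ₀.comp (α.symm : A →⋆ₙₐ[ℂ] A))

@[simp]
theorem NonUnitalStarAlgHom.twist_apply (φ₀ : A →⋆ₙₐ[ℂ] B) (α : A ≃⋆ₐ[ℂ] A) (β : B ≃⋆ₐ[ℂ] B)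
    (x : A) : φ₀.twist α β x = β (φ₀ (α.symm x)) := rfl

open scoped Classical in
/-- The inductive construction of the automorphisms and finite sets of an approximate
intertwining. -/
theorem exists_intertwining_data (φ₀ : A →⋆ₙₐ[ℂ] B) (ψ₀ : B →⋆ₙₐ[ℂ] A)
    (h₁ : ApproxMultiplierUnitarilyEquiv (fun a => ψ₀ (φ₀ a)) (id : A → A))
    (h₂ : ApproxMultiplierUnitarilyEquiv (fun b => φ₀ (ψ₀ b)) (id : B → B))
    (a : ℕ → A) (b : ℕ → B) :
    ∃ (α : ℕ → (A ≃⋆ₐ[ℂ] A)) (β : ℕ → (B ≃⋆ₐ[ℂ] B)) (F : ℕ → Finset A) (G : ℕ → Finset B),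
      (∀ n, α n ∈ unitaryAut A) ∧ (∀ n, β n ∈ unitaryAut B) ∧ Monotone F ∧ Monotone G ∧
      (∀ n, ∀ k < n, a k ∈ F n ∧ α n (a k) ∈ F n) ∧
      (∀ n, ∀ k < n, b k ∈ G n ∧ β n (b k) ∈ G n) ∧
      (∀ n, ∀ x ∈ F n, φ₀.twist (α n) (β n) x ∈ G n) ∧
      (∀ n, ∀ y ∈ G n, ψ₀.twist (β n) (α (n + 1)) y ∈ F (n + 1)) ∧
      (∀ n, ∀ x ∈ F n,
        dist (ψ₀.twist (β n) (α (n + 1)) (φ₀.twist (α n) (β n) x)) x ≤ 1 / 2 ^ n) ∧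
      (∀ n, ∀ y ∈ G n, dist (φ₀.twist (α (n + 1)) (β (n + 1))
        (ψ₀.twist (β n) (α (n + 1)) y)) y ≤ 1 / 2 ^ n) := by
  have hpos (n : ℕ) : (0 : ℝ) < 1 / 2 ^ n := by positivity
  choose ζ hζ hζd using fun (F : Finset A) (n : ℕ) => h₁.exists_aut_dist_le F (hpos n)
  choose η hη hηd using fun (G : Finset B) (n : ℕ) => h₂.exists_aut_dist_le G (hpos n)
  let nextα (n : ℕ) (α : A ≃⋆ₐ[ℂ] A) (F : Finset A) : A ≃⋆ₐ[ℂ] A := α * ζ (F.image α.symm) n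
  let nextβ (n : ℕ) (β : B ≃⋆ₐ[ℂ] B) (G : Finset B) : B ≃⋆ₐ[ℂ] B := β * η (G.image β.symm) n
  let nextF (n : ℕ) (α' : A ≃⋆ₐ[ℂ] A) (β : B ≃⋆ₐ[ℂ] B) (F : Finset A) (G : Finset B) : Finset A :=
    F ∪ G.image (ψ₀.twist β α') ∪
      ((Finset.range (n + 1)).image a ∪ (Finset.range (n + 1)).image fun k => α' (a k))
  let nextG (n : ℕ) (α' : A ≃⋆ₐ[ℂ] A) (β' : B ≃⋆ₐ[ℂ] B) (F' : Finset A) (G : Finset B) :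
      Finset B :=
    G ∪ F'.image (φ₀.twist α' β') ∪
      ((Finset.range (n + 1)).image b ∪ (Finset.range (n + 1)).image fun k => β' (b k))
  let state : ℕ → (A ≃⋆ₐ[ℂ] A) × (B ≃⋆ₐ[ℂ] B) × Finset A × Finset B := fun n =>
    Nat.rec (1, 1, ∅, ∅) (fun n s =>
      let α' := nextα n s.1 s.2.2.1
      let β' := nextβ n s.2.1 s.2.2.2
      let F' := nextF n α' s.2.1 s.2.2.1 s.2.2.2
      (α', β', F', nextG n α' β' F' s.2.2.2)) n
  let α n := (state n).1
  let β n := (state n).2.1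
  let F n := (state n).2.2.1
  let G n := (state n).2.2.2
  have hα (n : ℕ) : α (n + 1) = α n * ζ ((F n).image (α n).symm) n := rfl
  have hβ (n : ℕ) : β (n + 1) = β n * η ((G n).image (β n).symm) n := rfl
  have hF (n : ℕ) : F (n + 1) = F n ∪ (G n).image (ψ₀.twist (β n) (α (n + 1))) ∪
      ((Finset.range (n + 1)).image a ∪
        (Finset.range (n + 1)).image fun k => α (n + 1) (a k)) := rfl
  have hG (n : ℕ) : G (n + 1) = G n ∪ (F (n + 1)).image (φ₀.twist (α (n + 1)) (β (n + 1))) ∪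
      ((Finset.range (n + 1)).image b ∪
        (Finset.range (n + 1)).image fun k => β (n + 1) (b k)) := rfl
  have hF0 : F 0 = ∅ := rfl
  have hα0 : α 0 = 1 := rfl
  have hβ0 : β 0 = 1 := rfl
  clear_value α β F G
  refine ⟨α, β, F, G, ?_, ?_, monotone_nat_of_le_succ fun n => ?_,
    monotone_nat_of_le_succ fun n => ?_, ?_, ?_, ?_, ?_, ?_, ?_⟩
  · intro n
    induction n with
    | zero => exact hα0 ▸ one_mem _
    | succ n ih => exact hα n ▸ mul_mem ih (hζ _ _)
  · intro n
    induction n with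
    | zero => exact hβ0 ▸ one_mem _
    | succ n ih => exact hβ n ▸ mul_mem ih (hη _ _)
  · rw [hF]
    exact Finset.subset_union_left.trans Finset.subset_union_left
  · rw [hG]
    exact Finset.subset_union_left.trans Finset.subset_union_left
  · rintro (_ | n) k hk
    · exact absurd hk k.not_lt_zero
    · have hk' := Finset.mem_range.2 hk
      rw [hF]
      exact ⟨Finset.mem_union_right _ (Finset.mem_union_left _ (Finset.mem_image_of_mem _ hk')),
        Finset.mem_union_right _ (Finset.mem_union_right _
          (Finset.mem_image_of_mem (fun k => α (n + 1) (a k)) hk'))⟩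
  · rintro (_ | n) k hk
    · exact absurd hk k.not_lt_zero
    · have hk' := Finset.mem_range.2 hk
      rw [hG]
      exact ⟨Finset.mem_union_right _ (Finset.mem_union_left _ (Finset.mem_image_of_mem _ hk')),
        Finset.mem_union_right _ (Finset.mem_union_right _
          (Finset.mem_image_of_mem (fun k => β (n + 1) (b k)) hk'))⟩
  · rintro (_ | n) x hx
    · simp [hF0] at hx
    · rw [hG]
      exact Finset.mem_union_left _ (Finset.mem_union_right _ (Finset.mem_image_of_mem _ hx))
  · intro n y hy
    rw [hF]
    exact Finset.mem_union_left _ (Finset.mem_union_right _ (Finset.mem_image_of_mem _ hy))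
  · intro n x hx
    have h1 := hζd ((F n).image (α n).symm) n _ (Finset.mem_image_of_mem _ hx)
    have h2 := (NonUnitalStarAlgHom.dist_apply_le (α n : A →⋆ₙₐ[ℂ] A) _ _).trans h1
    simpa [hα] using h2
  · intro n y hy
    have h1 := hηd ((G n).image (β n).symm) n _ (Finset.mem_image_of_mem _ hy)
    have h2 := (NonUnitalStarAlgHom.dist_apply_le (β n : B →⋆ₙₐ[ℂ] B) _ _).trans h1
    simpa [hβ] using h2

end Intertwining

/-- If `ψ₀ ∘ φ₀ ≈ₘᵤ id` and `φ₀ ∘ ψ₀ ≈ₘᵤ id` for ⋆-homomorphisms between separable C⋆-algebras,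
then there is a ⋆-isomorphism `φ : A ≃ B` with `φ ≈ₘᵤ φ₀` and `φ⁻¹ ≈ₘᵤ ψ₀`. -/
theorem approxMultiplierUnitarilyEquiv_intertwining
    {A B : Type*} [NonUnitalCStarAlgebra A] [NonUnitalCStarAlgebra B]
    [TopologicalSpace.SeparableSpace A] [TopologicalSpace.SeparableSpace B]
    (φ₀ : A →⋆ₙₐ[ℂ] B) (ψ₀ : B →⋆ₙₐ[ℂ] A)
    (h₁ : ApproxMultiplierUnitarilyEquiv (fun a => ψ₀ (φ₀ a)) (id : A → A))
    (h₂ : ApproxMultiplierUnitarilyEquiv (fun b => φ₀ (ψ₀ b)) (id : B → B)) :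
    ∃ φ : A ≃⋆ₐ[ℂ] B,
      ApproxMultiplierUnitarilyEquiv (⇑φ) (⇑φ₀) ∧
        ApproxMultiplierUnitarilyEquiv (⇑φ.symm) (⇑ψ₀) := by
  have ha := TopologicalSpace.denseRange_denseSeq A
  have hb := TopologicalSpace.denseRange_denseSeq B
  obtain ⟨α, β, F, G, hα, hβ, hF, hG, haF, hbG, hφ, hψ, hψφ, hφψ⟩ :=
    exists_intertwining_data φ₀ ψ₀ h₁ h₂ (TopologicalSpace.denseSeq A)
      (TopologicalSpace.denseSeq B)
  obtain ⟨Φ, hΦ, hΦ'⟩ := exists_starAlgEquiv_of_approx_intertwining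
    (φ := fun n => φ₀.twist (α n) (β n)) (ψ := fun n => ψ₀.twist (β n) (α (n + 1)))
    (F := fun n => F n) (G := fun n => G n)
    (fun _ _ h => Finset.coe_subset.2 (hF h)) (fun _ _ h => Finset.coe_subset.2 (hG h))
    (ha.mono (Set.range_subset_iff.2 fun k => Set.mem_iUnion.2 ⟨k + 1, (haF _ k k.lt_succ_self).1⟩))
    (hb.mono (Set.range_subset_iff.2 fun k => Set.mem_iUnion.2 ⟨k + 1, (hbG _ k k.lt_succ_self).1⟩))
    hφ hψ hψφ hφψ
  refine ⟨Φ, approxMultiplierUnitarilyEquiv_of_dist_le Φ φ₀ ha hα hβ fun n k hk => ?_,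
    approxMultiplierUnitarilyEquiv_of_dist_le Φ.symm ψ₀ hb hβ (fun n => hα (n + 1))
      fun n k hk => ?_⟩
  · simpa using hΦ n _ (haF n k hk).2
  · simpa using hΦ' n _ (hbG n k hk).2
end

section
/- Let G be a finite group and A a separable C*-algebra. Let α⁰, α¹ : G → Aut(A) be two actions of G on A, each having the Rokhlin property, such that α⁰_g is approximately unitarily equivalent to α¹_g for every g ∈ G. Then there exists an approximately inner automorphism φ of A such that α¹_g ∘ φ = φ ∘ α⁰_g for all g ∈ G. -/
open Filter Topology

/-- An action of a finite group `G` on a C⋆-algebra `A` (given as a family of ⋆-automorphisms)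
has the Rokhlin property if for every `ε > 0` and every finite set `F ⊆ A` there are positive
contractions `(a_g)_{g ∈ G}` forming an approximate partition of unity that is approximately
permuted by the action, approximately orthogonal and approximately central, all relative to
`F`. -/
def RokhlinProperty {G A : Type*} [Group G] [Fintype G] [NonUnitalCStarAlgebra A]
    [PartialOrder A] [StarOrderedRing A] (α : G → A ≃⋆ₐ[ℂ] A) : Prop :=
  ∀ ε > (0 : ℝ), ∀ F : Finset A, ∃ a : G → A,
    (∀ g, 0 ≤ a g) ∧ (∀ g, ‖a g‖ ≤ 1) ∧
    (∀ x ∈ F, ‖(∑ g : G, a g) * x - x‖ ≤ ε) ∧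
    (∀ g h : G, ∀ x ∈ F, ‖(α g) (a h) * x - a (g * h) * x‖ ≤ ε) ∧
    (∀ g h : G, g ≠ h → ∀ x ∈ F, ‖a g * a h * x‖ ≤ ε) ∧
    (∀ g : G, ∀ x ∈ F, ‖a g * x - x * a g‖ ≤ ε)

open Unitization (norm_inr)

/-- An element of a unital C⋆-algebra which is unitary up to `δ` is within `4 * δ` of a unitary. -/
theorem exists_unitary_norm_sub_le {B : Type*} [CStarAlgebra B] {u : B} {δ : ℝ} (hδ : δ ≤ 1 / 2)
    (h₁ : ‖star u * u - 1‖ ≤ δ) (h₂ : ‖u * star u - 1‖ ≤ δ) :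
    ∃ v : unitary B, ‖(v : B) - u‖ ≤ 4 * δ := by
  have hδ0 : 0 ≤ δ := (norm_nonneg _).trans h₁
  set h : B := star u * u with hh
  have hsa : IsSelfAdjoint h := .star_mul_self u
  have hspec : ∀ t ∈ spectrum ℝ h, |t - 1| ≤ δ := by
    intro t ht
    have h3 : cfc (fun s : ℝ => s - 1) h = h - 1 := by
      rw [cfc_sub (fun s : ℝ => s) (fun _ => 1) h, cfc_id' ℝ h, cfc_const_one ℝ h]
    have := norm_apply_le_norm_cfc (fun s : ℝ => s - 1) h ht
    rw [h3] at this
    exact this.trans h₁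
  have hpos : ∀ t ∈ spectrum ℝ h, (1 / 2 : ℝ) ≤ t := fun t ht => by
    have := (abs_le.1 (hspec t ht)).1
    linarith
  have hcont : ContinuousOn (fun t : ℝ => (√t)⁻¹) (spectrum ℝ h) :=
    Real.continuous_sqrt.continuousOn.inv₀ fun t ht => by
      have := hpos t ht
      positivity
  set k : B := cfc (fun t : ℝ => (√t)⁻¹) h with hk
  have hksa : star k = k := (IsSelfAdjoint.cfc (f := fun t : ℝ => (√t)⁻¹) (a := h)).star_eq
  have hkhk : k * h * k = 1 := by
    have : cfc (fun t : ℝ => (√t)⁻¹ * t * (√t)⁻¹) h = 1 := by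
      rw [← cfc_const_one ℝ h]
      refine cfc_congr fun t ht => ?_
      have h4 := hpos t ht
      have h5 : 0 < √t := by positivity
      have h6 : √t * √t = t := Real.mul_self_sqrt (by linarith)
      rw [show (√t)⁻¹ * t * (√t)⁻¹ = (√t)⁻¹ * (√t * √t) * (√t)⁻¹ by rw [h6]]
      field_simp
    rw [← this, cfc_mul (fun t : ℝ => (√t)⁻¹ * t) (fun t => (√t)⁻¹) h
      (hcont.mul continuousOn_id) hcont, cfc_mul (fun t : ℝ => (√t)⁻¹) (fun t => t) h
      hcont continuousOn_id, cfc_id' ℝ h]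
  have hknorm : ‖k - 1‖ ≤ 2 * δ := by
    have : cfc (fun t : ℝ => (√t)⁻¹ - 1) h = k - 1 := by
      rw [cfc_sub (fun t : ℝ => (√t)⁻¹) (fun _ => 1) h hcont, cfc_const_one ℝ h]
    rw [← this]
    refine norm_cfc_le (by positivity) fun t ht => ?_
    have h4 := hpos t ht
    have h5 : 1 / 2 ≤ √t := Real.le_sqrt_of_sq_le (by linarith)
    have h6 : √t * √t = t := Real.mul_self_sqrt (by linarith)
    have h7 : (√t)⁻¹ - 1 = (1 - t) / (√t * (1 + √t)) := by
      field_simp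
      nlinarith
    rw [Real.norm_eq_abs, h7, abs_div, abs_sub_comm, abs_of_pos (by positivity : 0 < √t * (1 + √t)),
      div_le_iff₀ (by positivity)]
    nlinarith [hspec t ht]
  have hu : ‖u‖ ≤ 2 := by
    have h8 : ‖u‖ * ‖u‖ ≤ 3 / 2 := by
      rcases subsingleton_or_nontrivial B with hB | hB
      · rw [Subsingleton.elim u 0, norm_zero]
        norm_num
      · rw [← CStarRing.norm_star_mul_self, ← hh]
        calc ‖h‖ = ‖(h - 1) + 1‖ := by simp
          _ ≤ ‖h - 1‖ + ‖(1 : B)‖ := norm_add_le _ _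
          _ ≤ 3 / 2 := by rw [CStarRing.norm_one]; linarith
    nlinarith [norm_nonneg u]
  have hunit : ∀ x : B, ‖x - 1‖ ≤ δ → IsUnit x := fun x hx => by
    have := (Units.oneSub (1 - x) (by rw [norm_sub_rev]; linarith)).isUnit
    simpa using this
  have huu : IsUnit u := by
    obtain ⟨c, hc⟩ := (hunit _ h₁).exists_left_inv
    obtain ⟨d, hd⟩ := (hunit _ h₂).exists_right_inv
    rw [isUnit_iff_exists_and_exists]
    exact ⟨⟨star u * d, by rw [← mul_assoc, hd]⟩, ⟨c * star u, by rw [mul_assoc, hc]⟩⟩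
  have hku : IsUnit k := by
    rw [isUnit_iff_exists_and_exists]
    exact ⟨⟨h * k, by rw [← mul_assoc, hkhk]⟩, ⟨k * h, hkhk⟩⟩
  have hvv : star (u * k) * (u * k) = 1 := by
    rw [star_mul, hksa, ← hkhk, hh]
    noncomm_ring
  refine ⟨⟨u * k, Unitary.mem_iff.2 ⟨hvv, ?_⟩⟩, ?_⟩
  · obtain ⟨w, hw⟩ := (huu.mul hku).exists_right_inv
    have : star (u * k) = w := left_inv_eq_right_inv hvv hw
    rw [this, hw]
  · calc ‖u * k - u‖ = ‖u * (k - 1)‖ := by rw [mul_sub, mul_one]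
      _ ≤ ‖u‖ * ‖k - 1‖ := norm_mul_le _ _
      _ ≤ 2 * (2 * δ) := by gcongr
      _ = 4 * δ := by ring

theorem Unitization.inr_snd_conj {A : Type*} [NonUnitalCStarAlgebra A] (u v : Unitization ℂ A)
    (a : A) : ((u * a * v).snd : Unitization ℂ A) = u * a * v := by
  apply Unitization.ext <;> simp

/-- The automorphism of a C⋆-algebra induced by conjugation with a unitary of its minimal
unitalization. -/
noncomputable def innerAut (A : Type*) [NonUnitalCStarAlgebra A] :
    unitary (Unitization ℂ A) →* (A ≃⋆ₐ[ℂ] A) where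
  toFun u :=
    { toFun := fun a =>
        ((u : Unitization ℂ A) * (a : Unitization ℂ A) * star (u : Unitization ℂ A)).snd
      invFun := fun a =>
        (star (u : Unitization ℂ A) * (a : Unitization ℂ A) * (u : Unitization ℂ A)).snd
      left_inv := fun a => by
        apply Unitization.inr_injective (R := ℂ)
        simp only [Unitization.inr_snd_conj, ← mul_assoc]
        simp [mul_assoc]
      right_inv := fun a => by
        apply Unitization.inr_injective (R := ℂ)
        simp only [Unitization.inr_snd_conj, ← mul_assoc]
        simp [mul_assoc]
      map_mul' := fun a b => by
        apply Unitization.inr_injective (R := ℂ)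
        simp only [Unitization.inr_mul, Unitization.inr_snd_conj]
        rw [← Unitization.inr_mul, Unitization.inr_snd_conj, Unitization.inr_mul]
        simp only [mul_assoc]
        rw [← mul_assoc (star (u : Unitization ℂ A)) (u : Unitization ℂ A)]
        simp
      map_add' := fun a b => by
        simp [mul_add, add_mul]
      map_star' := fun a => by
        apply Unitization.inr_injective (R := ℂ)
        rw [Unitization.inr_snd_conj, Unitization.inr_star, Unitization.inr_star,
          Unitization.inr_snd_conj]
        simp [mul_assoc]
      map_smul' := fun c a => by
        apply Unitization.inr_injective (R := ℂ)
        rw [Unitization.inr_snd_conj, Unitization.inr_smul, Unitization.inr_smul,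
          Unitization.inr_snd_conj]
        simp }
  map_one' := by
    ext a
    change ((1 : Unitization ℂ A) * (a : Unitization ℂ A) * star (1 : Unitization ℂ A)).snd = a
    simp
  map_mul' u v := by
    ext a
    apply Unitization.inr_injective (R := ℂ)
    change ((((u * v : unitary (Unitization ℂ A)) : Unitization ℂ A) * (a : Unitization ℂ A) *
      star ((u * v : unitary (Unitization ℂ A)) : Unitization ℂ A)).snd : Unitization ℂ A) =
      (((u : Unitization ℂ A) * ((((v : Unitization ℂ A) * (a : Unitization ℂ A) *
      star (v : Unitization ℂ A)).snd : A) : Unitization ℂ A) *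
      star (u : Unitization ℂ A)).snd : Unitization ℂ A)
    rw [Unitization.inr_snd_conj, Unitization.inr_snd_conj, Unitization.inr_snd_conj]
    simp [mul_assoc]

theorem inr_innerAut {A : Type*} [NonUnitalCStarAlgebra A] (u : unitary (Unitization ℂ A)) (a : A) :
    (innerAut A u a : Unitization ℂ A) =
      (u : Unitization ℂ A) * (a : Unitization ℂ A) * star (u : Unitization ℂ A) :=
  Unitization.inr_snd_conj _ _ _

section Inner

variable {A : Type*} [NonUnitalCStarAlgebra A]

theorem StarAlgEquiv.norm_apply_sub_apply (f : A ≃⋆ₐ[ℂ] A) (a b : A) : ‖f a - f b‖ = ‖a - b‖ := by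
  rw [← map_sub, StarAlgEquiv.norm_map]

@[simp]
theorem StarAlgEquiv.inv_apply_apply (f : A ≃⋆ₐ[ℂ] A) (a : A) : f⁻¹ (f a) = a :=
  f.symm_apply_apply a

@[simp]
theorem StarAlgEquiv.apply_inv_apply (f : A ≃⋆ₐ[ℂ] A) (a : A) : f (f⁻¹ a) = a :=
  f.apply_symm_apply a

theorem StarAlgEquiv.norm_inv_apply_sub (f : A ≃⋆ₐ[ℂ] A) (a b : A) :
    ‖f⁻¹ a - b‖ = ‖a - f b‖ := by
  rw [← StarAlgEquiv.norm_apply_sub_apply f, StarAlgEquiv.apply_inv_apply]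

/-- Conjugating an inner automorphism gives an inner automorphism. -/
theorem conj_mem_range_innerAut (f : A ≃⋆ₐ[ℂ] A) {i : A ≃⋆ₐ[ℂ] A}
    (hi : i ∈ (innerAut A).range) : f * i * f⁻¹ ∈ (innerAut A).range := by
  obtain ⟨u, rfl⟩ := hi
  let F : Unitization ℂ A →⋆ₐ[ℂ] Unitization ℂ A := Unitization.starMap (f : A →⋆ₙₐ[ℂ] A)
  have hF : ∀ a : A, F a = ((f a : A) : Unitization ℂ A) := fun a => Unitization.starMap_inr _ a
  refine ⟨⟨F u, Unitary.map_mem F u.2⟩, ?_⟩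
  ext a
  apply Unitization.inr_injective (R := ℂ)
  rw [inr_innerAut, StarAlgEquiv.mul_apply, StarAlgEquiv.mul_apply, ← hF, inr_innerAut,
    map_mul, map_mul, map_star, hF, StarAlgEquiv.apply_inv_apply]

/-- The subgroup of approximately inner automorphisms: the point-norm closure of the inner ones. -/
noncomputable def approxInner (A : Type*) [NonUnitalCStarAlgebra A] :
    Subgroup (A ≃⋆ₐ[ℂ] A) where
  carrier := {f | ∀ (F : Finset A) (ε : ℝ), 0 < ε →
    ∃ i ∈ (innerAut A).range, ∀ x ∈ F, ‖i x - f x‖ ≤ ε}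
  one_mem' := fun _ _ hε => ⟨1, one_mem _, fun _ _ => by simpa using hε.le⟩
  mul_mem' := by
    classical
    intro f g hf hg F ε hε
    obtain ⟨j, hj, hjF⟩ := hg F (ε / 2) (half_pos hε)
    obtain ⟨i, hi, hiF⟩ := hf (F.image g) (ε / 2) (half_pos hε)
    refine ⟨i * j, mul_mem hi hj, fun x hx => ?_⟩
    calc ‖(i * j) x - (f * g) x‖ ≤ ‖i (j x) - i (g x)‖ + ‖i (g x) - f (g x)‖ :=
          norm_sub_le_norm_sub_add_norm_sub _ _ _
      _ ≤ ε / 2 + ε / 2 := by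
          rw [StarAlgEquiv.norm_apply_sub_apply]
          exact add_le_add (hjF x hx) (hiF _ (Finset.mem_image_of_mem _ hx))
      _ = ε := add_halves ε
  inv_mem' := by
    classical
    intro f hf F ε hε
    obtain ⟨i, hi, hiF⟩ := hf (F.image (f⁻¹ : A ≃⋆ₐ[ℂ] A)) ε hε
    refine ⟨i⁻¹, inv_mem hi, fun x hx => ?_⟩
    have := hiF _ (Finset.mem_image_of_mem _ hx)
    rwa [StarAlgEquiv.apply_inv_apply, norm_sub_rev, ← StarAlgEquiv.norm_inv_apply_sub] at this

instance : (approxInner A).Normal where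
  conj_mem := by
    classical
    intro f hf g F ε hε
    obtain ⟨i, hi, hiF⟩ := hf (F.image (g⁻¹ : A ≃⋆ₐ[ℂ] A)) ε hε
    refine ⟨g * i * g⁻¹, conj_mem_range_innerAut g hi, fun x hx => ?_⟩
    have := hiF _ (Finset.mem_image_of_mem _ hx)
    simpa only [StarAlgEquiv.mul_apply, StarAlgEquiv.norm_apply_sub_apply] using this

theorem range_innerAut_le_approxInner : (innerAut A).range ≤ approxInner A :=
  fun i hi _ _ hε => ⟨i, hi, fun _ _ => by simpa using hε.le⟩

theorem ApproxUnitarilyEquiv.mul_inv_mem_approxInner {f g : A ≃⋆ₐ[ℂ] A}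
    (h : ApproxUnitarilyEquiv (⇑f) (⇑g)) : g * f⁻¹ ∈ approxInner A := by
  obtain ⟨u, hu⟩ := h
  intro F ε hε
  have : ∀ᶠ n in atTop, ∀ x ∈ F, ‖innerAut A (u n) x - (g * f⁻¹) x‖ ≤ ε := by
    rw [Filter.eventually_all_finset]
    intro x _
    filter_upwards [(hu (f⁻¹ x)).eventually_le_const hε] with n hn
    rw [← norm_inr (𝕜 := ℂ), Unitization.inr_sub, inr_innerAut]
    simpa using hn
  obtain ⟨n, hn⟩ := this.exists
  exact ⟨_, ⟨u n, rfl⟩, hn⟩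

end Inner

section WeightedSum

variable {A G : Type*} [NonUnitalCStarAlgebra A] [Fintype G]

/-- The sum `∑ g, c g * x g`. For Rokhlin elements `c` this is approximately multiplicative,
⋆-preserving and equivariant in `x`. -/
def weightedSum (c x : G → A) : A := ∑ g, c g * x g

theorem weightedSum_add (c x y : G → A) :
    weightedSum c (x + y) = weightedSum c x + weightedSum c y := by
  simp [weightedSum, mul_add, Finset.sum_add_distrib]

theorem weightedSum_sub (c x y : G → A) :
    weightedSum c (x - y) = weightedSum c x - weightedSum c y := by
  simp [weightedSum, mul_sub, Finset.sum_sub_distrib]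

theorem norm_weightedSum_le {c : G → A} (hc : ∀ g, ‖c g‖ ≤ 1) (x : G → A) :
    ‖weightedSum c x‖ ≤ ∑ g, ‖x g‖ := by
  refine norm_sum_le_of_le _ fun g _ => (norm_mul_le _ _).trans ?_
  simpa using mul_le_mul_of_nonneg_right (hc g) (norm_nonneg (x g))

end WeightedSum

theorem tendsto_mul_sub_mul {ι R : Type*} [NonUnitalNormedRing R] {l : Filter ι}
    {f f' g g' : ι → R} {C D : ℝ}
    (hf : ∀ n, ‖f n‖ ≤ C) (hg' : ∀ n, ‖g' n‖ ≤ D)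
    (hff' : Tendsto (fun n => f n - f' n) l (𝓝 0)) (hgg' : Tendsto (fun n => g n - g' n) l (𝓝 0)) :
    Tendsto (fun n => f n * g n - f' n * g' n) l (𝓝 0) := by
  have h : Tendsto (fun n => C * ‖g n - g' n‖ + ‖f n - f' n‖ * D) l (𝓝 0) := by
    simpa using (hgg'.norm.const_mul C).add (hff'.norm.mul_const D)
  refine squeeze_zero_norm (fun n => ?_) h
  calc ‖f n * g n - f' n * g' n‖ = ‖f n * (g n - g' n) + (f n - f' n) * g' n‖ := by
        congr 1
        noncomm_ring
    _ ≤ ‖f n * (g n - g' n)‖ + ‖(f n - f' n) * g' n‖ := norm_add_le _ _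
    _ ≤ C * ‖g n - g' n‖ + ‖f n - f' n‖ * D := by
        refine add_le_add ((norm_mul_le _ _).trans ?_) ((norm_mul_le _ _).trans ?_)
        · exact mul_le_mul_of_nonneg_right (hf n) (norm_nonneg _)
        · exact mul_le_mul_of_nonneg_left (hg' n) (norm_nonneg _)

section Rokhlin

variable {A : Type*} [NonUnitalCStarAlgebra A] {G ι : Type*} [Group G] [Fintype G]
  {l : Filter ι} {a : ι → G → A}

/-- A net of families of selfadjoint contractions witnessing the Rokhlin property of `β`. -/
structure IsRokhlinNet (β : G →* (A ≃⋆ₐ[ℂ] A)) (l : Filter ι) (a : ι → G → A) : Prop where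
  star_eq : ∀ n g, star (a n g) = a n g
  norm_le : ∀ n g, ‖a n g‖ ≤ 1
  sum_mul : ∀ x, Tendsto (fun n => (∑ g, a n g) * x - x) l (𝓝 0)
  equivariant : ∀ g h x, Tendsto (fun n => β g (a n h) * x - a n (g * h) * x) l (𝓝 0)
  orthogonal : ∀ g h, g ≠ h → ∀ x, Tendsto (fun n => a n g * a n h * x) l (𝓝 0)
  central : ∀ g x, Tendsto (fun n => a n g * x - x * a n g) l (𝓝 0)

theorem RokhlinProperty.exists_isRokhlinNet [PartialOrder A] [StarOrderedRing A]
    {β : G →* (A ≃⋆ₐ[ℂ] A)} (h : RokhlinProperty (⇑β)) :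
    ∃ a : Finset A × ℕ → G → A, IsRokhlinNet β atTop a := by
  classical
  choose a h0 h1 h2 h3 h4 h5 using fun p : Finset A × ℕ =>
    h (1 / ((p.2 : ℝ) + 1)) Nat.one_div_pos_of_nat p.1
  have hlim : Tendsto (fun p : Finset A × ℕ => 1 / ((p.2 : ℝ) + 1)) atTop (𝓝 0) := by
    rw [← prod_atTop_atTop_eq]
    exact tendsto_one_div_add_atTop_nhds_zero_nat.comp tendsto_snd
  have key : ∀ (f : Finset A × ℕ → A) (x : A),
      (∀ p, x ∈ p.1 → ‖f p‖ ≤ 1 / ((p.2 : ℝ) + 1)) → Tendsto f atTop (𝓝 0) := by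
    intro f x hf
    refine squeeze_zero_norm' ?_ hlim
    filter_upwards [eventually_ge_atTop (({x}, 0) : Finset A × ℕ)] with p hp
    exact hf p (hp.1 (Finset.mem_singleton_self x))
  exact ⟨a,
    { star_eq := fun n g => (IsSelfAdjoint.of_nonneg (h0 n g)).star_eq
      norm_le := h1
      sum_mul := fun x => key _ x fun p hp => h2 p x hp
      equivariant := fun g k x => key _ x fun p hp => h3 p g k x hp
      orthogonal := fun g k hgk x => key _ x fun p hp => h4 p g k hgk x hp
      central := fun g x => key _ x fun p hp => h5 p g x hp }⟩

theorem IsRokhlinNet.conj {β : G →* (A ≃⋆ₐ[ℂ] A)} (h : IsRokhlinNet β l a) (ψ : A ≃⋆ₐ[ℂ] A) :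
    IsRokhlinNet ((MulAut.conj ψ).toMonoidHom.comp β) l (fun n g => ψ (a n g)) := by
  have key : ∀ f : ι → A, Tendsto f l (𝓝 0) → Tendsto (fun n => ψ (f n)) l (𝓝 0) := by
    intro f hf
    simpa [Function.comp_def] using ((StarAlgEquiv.isometry ψ).continuous.tendsto 0).comp hf
  constructor
  · intro n g
    rw [← map_star, h.star_eq]
  · intro n g
    rw [StarAlgEquiv.norm_map]
    exact h.norm_le n g
  · intro x
    simpa using key _ (h.sum_mul (ψ⁻¹ x))
  · intro g k x
    simpa using key _ (h.equivariant g k (ψ⁻¹ x))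
  · intro g k hgk x
    simpa using key _ (h.orthogonal g k hgk (ψ⁻¹ x))
  · intro g x
    simpa using key _ (h.central g (ψ⁻¹ x))

namespace IsRokhlinNet

variable {β : G →* (A ≃⋆ₐ[ℂ] A)}

theorem tendsto_const (h : IsRokhlinNet β l a) (x : A) :
    Tendsto (fun n => weightedSum (a n) (fun _ => x) - x) l (𝓝 0) := by
  simpa [weightedSum, Finset.sum_mul] using h.sum_mul x

theorem tendsto_star (h : IsRokhlinNet β l a) (x : G → A) :
    Tendsto (fun n => star (weightedSum (a n) x) - weightedSum (a n) (star x)) l (𝓝 0) := by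
  have : Tendsto (fun n => ∑ g, -(a n g * star (x g) - star (x g) * a n g)) l (𝓝 (∑ _g : G, 0)) :=
    tendsto_finsetSum _ fun g _ => by simpa using (h.central g (star (x g))).neg
  simpa [weightedSum, star_sum, h.star_eq, Finset.sum_sub_distrib] using this

theorem tendsto_equivariant (h : IsRokhlinNet β l a) (k : G) (x : G → A) :
    Tendsto (fun n => β k (weightedSum (a n) x) -
      weightedSum (a n) (fun g => β k (x (k⁻¹ * g)))) l (𝓝 0) := by
  have : Tendsto (fun n => ∑ g, (β k (a n g) * β k (x g) - a n (k * g) * β k (x g))) l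
      (𝓝 (∑ _g : G, 0)) :=
    tendsto_finsetSum _ fun g _ => h.equivariant k g (β k (x g))
  simp only [Finset.sum_const_zero, Finset.sum_sub_distrib] at this
  refine this.congr fun n => ?_
  simp only [weightedSum, map_sum, map_mul]
  congr 1
  refine Fintype.sum_equiv (Equiv.mulLeft k) _ _ fun g => ?_
  simp

theorem tendsto_mul_self (h : IsRokhlinNet β l a) (g : G) (x : A) :
    Tendsto (fun n => a n g * a n g * x - a n g * x) l (𝓝 0) := by
  classical
  have h1 : Tendsto (fun n => a n g * ((∑ k, a n k) * x - x)) l (𝓝 0) := by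
    refine squeeze_zero_norm (fun n => (norm_mul_le _ _).trans ?_) (by simpa using (h.sum_mul x).norm)
    simpa using mul_le_mul_of_nonneg_right (h.norm_le n g) (norm_nonneg ((∑ k, a n k) * x - x))
  have h2 : Tendsto (fun n => ∑ k ∈ Finset.univ.erase g, a n g * a n k * x) l
      (𝓝 (∑ _k ∈ Finset.univ.erase g, 0)) :=
    tendsto_finsetSum _ fun k hk => h.orthogonal g k (Finset.ne_of_mem_erase hk).symm x
  have h3 := h1.sub h2
  simp only [Finset.sum_const_zero, sub_zero] at h3
  refine h3.congr fun n => ?_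
  rw [← Finset.add_sum_erase _ _ (Finset.mem_univ g), ← Finset.sum_mul, ← Finset.mul_sum]
  noncomm_ring

theorem tendsto_mul (h : IsRokhlinNet β l a) (x y : G → A) :
    Tendsto (fun n => weightedSum (a n) x * weightedSum (a n) y - weightedSum (a n) (x * y)) l
      (𝓝 0) := by
  classical
  have key : ∀ g k, Tendsto (fun n => a n g * x g * (a n k * y k) -
      if g = k then a n g * (x g * y g) else 0) l (𝓝 0) := by
    intro g k
    have h1 : Tendsto (fun n => a n g * (a n k * x g - x g * a n k) * y k) l (𝓝 0) := by
      refine squeeze_zero_norm (a := fun n => ‖a n k * x g - x g * a n k‖ * ‖y k‖)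
        (fun n => (norm_mul_le _ _).trans ?_)
        (by simpa using (h.central k (x g)).norm.mul_const ‖y k‖)
      refine mul_le_mul_of_nonneg_right ((norm_mul_le _ _).trans ?_) (norm_nonneg _)
      simpa using mul_le_mul_of_nonneg_right (h.norm_le n g)
        (norm_nonneg (a n k * x g - x g * a n k))
    by_cases hgk : g = k
    · subst hgk
      have h2 := (h.tendsto_mul_self g (x g * y g)).sub h1
      simp only [sub_zero] at h2
      refine h2.congr fun n => ?_
      simp only [if_true]
      noncomm_ring
    · have h2 := (h.orthogonal g k hgk (x g * y k)).sub h1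
      simp only [sub_zero] at h2
      refine h2.congr fun n => ?_
      simp only [if_neg hgk]
      noncomm_ring
  have := tendsto_finsetSum (Finset.univ : Finset G) fun g _ =>
    tendsto_finsetSum (Finset.univ : Finset G) fun k _ => key g k
  simp only [Finset.sum_const_zero] at this
  refine this.congr fun n => ?_
  simp [weightedSum, Finset.sum_mul_sum, Finset.sum_sub_distrib]

end IsRokhlinNet

end Rokhlin

section Perturbation

variable {A : Type*} [NonUnitalCStarAlgebra A]

/-- Every inner automorphism is implemented by a unitary whose scalar part is `1`. -/
theorem exists_fst_eq_one_innerAut_eq (w : unitary (Unitization ℂ A)) :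
    ∃ w' : unitary (Unitization ℂ A), (w' : Unitization ℂ A).fst = 1 ∧
      innerAut A w' = innerAut A w := by
  set c : ℂ := (w : Unitization ℂ A).fst with hc
  have hcc : star c * c = 1 := by
    have := congrArg (fun z : Unitization ℂ A => z.fst) (Unitary.star_mul_self_of_mem w.2)
    simpa only [Unitization.fst_mul, Unitization.fst_star, Unitization.fst_one] using this
  have hcc' : c * star c = 1 := by rw [mul_comm, hcc]
  refine ⟨⟨star c • (w : Unitization ℂ A), ?_⟩, ?_, ?_⟩
  · rw [Unitary.mem_iff]
    constructor
    · rw [star_smul, smul_mul_smul_comm, star_star, hcc', Unitary.star_mul_self_of_mem w.2, one_smul]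
    · rw [star_smul, smul_mul_smul_comm, star_star, hcc, Unitary.mul_star_self_of_mem w.2, one_smul]
  · rw [Unitization.fst_smul, ← hc, smul_eq_mul, hcc]
  · ext x
    apply Unitization.inr_injective (R := ℂ)
    rw [inr_innerAut, inr_innerAut]
    change star c • (w : Unitization ℂ A) * (x : Unitization ℂ A) *
      star (star c • (w : Unitization ℂ A)) = _
    rw [star_smul, star_star, smul_mul_assoc, smul_mul_smul_comm, hcc, one_smul]

/-- A net of approximate unitaries is asymptotic to a net of unitaries. -/
theorem exists_unitary_tendsto_sub {B ι : Type*} [CStarAlgebra B] {l : Filter ι} {u : ι → B}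
    (h₁ : Tendsto (fun n => star (u n) * u n - 1) l (𝓝 0))
    (h₂ : Tendsto (fun n => u n * star (u n) - 1) l (𝓝 0)) :
    ∃ v : ι → unitary B, Tendsto (fun n => (v n : B) - u n) l (𝓝 0) := by
  classical
  set δ : ι → ℝ := fun n => max ‖star (u n) * u n - 1‖ ‖u n * star (u n) - 1‖ with hδ
  have hlim : Tendsto δ l (𝓝 0) := by
    simpa using h₁.norm.max h₂.norm
  have hex : ∀ n, ∃ v : unitary B, δ n ≤ 1 / 2 → ‖(v : B) - u n‖ ≤ 4 * δ n := fun n => by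
    by_cases hn : δ n ≤ 1 / 2
    · obtain ⟨v, hv⟩ := exists_unitary_norm_sub_le hn (le_max_left _ _) (le_max_right _ _)
      exact ⟨v, fun _ => hv⟩
    · exact ⟨1, fun h => absurd h hn⟩
  choose v hv using hex
  refine ⟨v, squeeze_zero_norm' ?_ (by simpa using hlim.const_mul 4)⟩
  filter_upwards [hlim.eventually_le_const (by norm_num : (0 : ℝ) < 1 / 2)] with n hn
  exact hv n hn

variable {G ι : Type*} [Group G] [Fintype G] {l : Filter ι} {a : ι → G → A}
  {β : G →* (A ≃⋆ₐ[ℂ] A)}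

/-- Unitaries `w g` can be glued along a Rokhlin net to unitaries whose inner automorphisms
are asymptotically the weighted sums of those induced by the `w g`. -/
theorem IsRokhlinNet.exists_unitary_tendsto (h : IsRokhlinNet β l a)
    (w : G → unitary (Unitization ℂ A)) :
    ∃ v : ι → unitary (Unitization ℂ A), ∀ x, Tendsto (fun n =>
      innerAut A (v n) x - weightedSum (a n) (fun g => innerAut A (w g) x)) l (𝓝 0) := by
  choose w' hw1 hw' using fun g => exists_fst_eq_one_innerAut_eq (w g)
  set b : G → A := fun g => (w' g : Unitization ℂ A).snd with hb
  have hwb : ∀ g, (w' g : Unitization ℂ A) = 1 + (b g : Unitization ℂ A) := fun g => by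
    apply Unitization.ext
    · simp [hw1]
    · simp [hb]
  have hsb : b + star b + star b * b = 0 := by
    ext g
    apply Unitization.inr_injective (R := ℂ)
    have := Unitary.star_mul_self_of_mem (w' g).2
    rw [hwb, star_add, star_one] at this
    simp only [Pi.add_apply, Pi.mul_apply, Pi.star_apply, Pi.zero_apply, Unitization.inr_add,
      Unitization.inr_mul, Unitization.inr_star, Unitization.inr_zero]
    rw [← sub_eq_zero.2 this]
    noncomm_ring
  have hbs : b + star b + b * star b = 0 := by
    ext g
    apply Unitization.inr_injective (R := ℂ)
    have := Unitary.mul_star_self_of_mem (w' g).2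
    rw [hwb, star_add, star_one] at this
    simp only [Pi.add_apply, Pi.mul_apply, Pi.star_apply, Pi.zero_apply, Unitization.inr_add,
      Unitization.inr_mul, Unitization.inr_star, Unitization.inr_zero]
    rw [← sub_eq_zero.2 this]
    noncomm_ring
  have hwx : ∀ x, (fun g => innerAut A (w g) x) =
      (fun _ => x) + b * (fun _ => x) + (fun _ => x) * star b + b * (fun _ => x) * star b := by
    intro x
    ext g
    apply Unitization.inr_injective (R := ℂ)
    rw [← hw', inr_innerAut, hwb, star_add, star_one]
    simp only [Pi.add_apply, Pi.mul_apply, Pi.star_apply, Unitization.inr_add,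
      Unitization.inr_mul, Unitization.inr_star]
    noncomm_ring
  set S : ι → (G → A) → A := fun n x => weightedSum (a n) x with hS
  have hSle : ∀ x n, ‖S n x‖ ≤ ∑ g, ‖x g‖ := fun x n => norm_weightedSum_le (h.norm_le n) x
  have hSstar : Tendsto (fun n => star (S n b) - S n (star b)) l (𝓝 0) := h.tendsto_star b
  have hmul : ∀ x y, Tendsto (fun n => S n x * S n y - S n (x * y)) l (𝓝 0) := h.tendsto_mul
  have hstarS : ∀ n, ‖star (S n b)‖ ≤ ∑ g, ‖b g‖ := fun n => by
    rw [norm_star]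
    exact hSle b n
  have hnull : ∀ f : ι → A, Tendsto f l (𝓝 0) →
      Tendsto (fun n => (f n : Unitization ℂ A)) l (𝓝 0) := fun f hf => by
    rw [tendsto_zero_iff_norm_tendsto_zero] at hf ⊢
    simpa only [norm_inr] using hf
  have hsub : ∀ f : ι → A, Tendsto (fun n => f n - f n) l (𝓝 0) := fun f => by
    simp only [sub_self]
    exact tendsto_const_nhds
  set u : ι → Unitization ℂ A := fun n => 1 + (S n b : Unitization ℂ A) with hu
  have h₁ : Tendsto (fun n => star (u n) * u n - 1) l (𝓝 0) := by
    have e1 := tendsto_mul_sub_mul (l := l) hstarS (hSle b) hSstar (hsub fun n => S n b)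
    have e2 := (hSstar.add e1).add (hmul (star b) b)
    rw [add_zero, add_zero] at e2
    refine (hnull _ e2).congr fun n => ?_
    have e3 : S n b + S n (star b) + S n (star b * b) = 0 := by
      rw [hS, ← weightedSum_add, ← weightedSum_add, hsb]
      simp [weightedSum]
    have e4 : S n b = - S n (star b) - S n (star b * b) := by
      rw [← sub_eq_zero, ← e3]
      abel
    have e5 : star (u n) * u n - 1 =
        ((S n b + star (S n b) + star (S n b) * S n b : A) : Unitization ℂ A) := by
      simp only [hu, star_add, star_one, Unitization.inr_add, Unitization.inr_mul,
        Unitization.inr_star]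
      noncomm_ring
    rw [e5]
    congr 1
    rw [← sub_eq_zero, ← neg_eq_zero, ← e3]
    abel
  have h₂ : Tendsto (fun n => u n * star (u n) - 1) l (𝓝 0) := by
    have e1 := tendsto_mul_sub_mul (l := l) (hSle b) (hSle (star b)) (hsub fun n => S n b) hSstar
    have e2 := (hSstar.add e1).add (hmul b (star b))
    rw [add_zero, add_zero] at e2
    refine (hnull _ e2).congr fun n => ?_
    have e3 : S n b + S n (star b) + S n (b * star b) = 0 := by
      rw [hS, ← weightedSum_add, ← weightedSum_add, hbs]
      simp [weightedSum]
    have e5 : u n * star (u n) - 1 =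
        ((S n b + star (S n b) + S n b * star (S n b) : A) : Unitization ℂ A) := by
      simp only [hu, star_add, star_one, Unitization.inr_add, Unitization.inr_mul,
        Unitization.inr_star]
      noncomm_ring
    rw [e5]
    congr 1
    rw [← sub_eq_zero, ← neg_eq_zero, ← e3]
    abel
  obtain ⟨v, hv⟩ := exists_unitary_tendsto_sub h₁ h₂
  refine ⟨v, fun x => ?_⟩
  set c : G → A := fun _ => x with hcdef
  have hx : Tendsto (fun n => x - S n c) l (𝓝 0) := by
    simpa using (h.tendsto_const x).neg
  have f1 : Tendsto (fun n => S n b * x - S n b * S n c) l (𝓝 0) :=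
    tendsto_mul_sub_mul (hSle b) (hSle c) (hsub _) hx
  have f1' : Tendsto (fun n => S n b * x - S n (b * c)) l (𝓝 0) := by
    simpa using f1.add (hmul b c)
  have f2 : Tendsto (fun n => x * star (S n b) - S n (c * star b)) l (𝓝 0) := by
    simpa using (tendsto_mul_sub_mul (C := ‖x‖) (fun _ => le_rfl) (hSle (star b)) hx hSstar).add
      (hmul c (star b))
  have f3 : Tendsto (fun n => S n b * x * star (S n b) - S n (b * c * star b)) l (𝓝 0) := by
    simpa using (tendsto_mul_sub_mul (C := (∑ g, ‖b g‖) * ‖x‖)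
      (fun n => (norm_mul_le _ _).trans (mul_le_mul_of_nonneg_right (hSle b n) (norm_nonneg x)))
      (hSle (star b)) f1' hSstar).add (hmul (b * c) (star b))
  have f4 : Tendsto (fun n => u n * (x : Unitization ℂ A) * star (u n) -
      ((S n (fun g => innerAut A (w g) x) : A) : Unitization ℂ A)) l (𝓝 0) := by
    have f5 := ((hx.add f1').add f2).add f3
    simp only [add_zero] at f5
    refine (hnull _ f5).congr fun n => ?_
    have f6 : u n * (x : Unitization ℂ A) * star (u n) =
        ((x + S n b * x + x * star (S n b) + S n b * x * star (S n b) : A) : Unitization ℂ A) := by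
      simp only [hu, star_add, star_one, Unitization.inr_add, Unitization.inr_mul,
        Unitization.inr_star]
      noncomm_ring
    rw [f6, ← Unitization.inr_sub, hwx]
    congr 1
    simp only [hS, weightedSum_add]
    abel
  have hvle : ∀ n, ‖(v n : Unitization ℂ A)‖ ≤ 1 := fun n =>
    CStarRing.norm_of_mem_unitary (v n).2 |>.le
  have hule : ∀ n, ‖star (u n)‖ ≤ 1 + ∑ g, ‖b g‖ := fun n => by
    rw [norm_star]
    refine (norm_add_le _ _).trans ?_
    rw [CStarRing.norm_one, norm_inr]
    exact add_le_add_right (hSle b n) 1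
  have f7 : Tendsto (fun n => (v n : Unitization ℂ A) * (x : Unitization ℂ A) -
      u n * (x : Unitization ℂ A)) l (𝓝 0) :=
    tendsto_mul_sub_mul (D := ‖(x : Unitization ℂ A)‖) hvle (fun _ => le_rfl) hv
      (by simpa only [sub_self] using tendsto_const_nhds)
  have f8 : Tendsto (fun n => star (v n : Unitization ℂ A) - star (u n)) l (𝓝 0) := by
    rw [tendsto_zero_iff_norm_tendsto_zero] at hv ⊢
    simpa only [← star_sub, norm_star] using hv
  have f9 := (tendsto_mul_sub_mul (C := ‖(x : Unitization ℂ A)‖) (fun n => (norm_mul_le _ _).trans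
    (mul_le_of_le_one_left (norm_nonneg _) (hvle n)))
    hule f7 f8).add f4
  rw [add_zero, tendsto_zero_iff_norm_tendsto_zero] at f9
  rw [tendsto_zero_iff_norm_tendsto_zero]
  refine f9.congr fun n => ?_
  rw [sub_add_sub_cancel, ← inr_innerAut, ← Unitization.inr_sub, norm_inr]

end Perturbation

section Intertwining

variable {A : Type*} [NonUnitalCStarAlgebra A] {G ι : Type*} [Group G] [Fintype G]
  {l : Filter ι} [l.NeBot] {a : ι → G → A} {α β : G →* (A ≃⋆ₐ[ℂ] A)}

/-- If `α` and `β` agree modulo approximately inner automorphisms and `β` is Rokhlin, then some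
inner automorphism is approximately equivariant from `α` to `β`, and it is close to the
identity where `α` is close to `β`. -/
theorem IsRokhlinNet.exists_inner_approx_equivariant (h : IsRokhlinNet β l a)
    (hαβ : ∀ g, β g * (α g)⁻¹ ∈ approxInner A) {F : Set A} (hF : F.Finite) {F' : Set A}
    (hF' : F'.Finite) {δ ε : ℝ} (hε : 0 < ε) (hδ : ∀ g, ∀ x ∈ F, ‖α g x - β g x‖ ≤ δ) :
    ∃ i ∈ (innerAut A).range, (∀ x ∈ F, ‖i x - x‖ ≤ Fintype.card G * δ + ε) ∧
      ∀ g, ∀ x ∈ F', ‖β g (i x) - i (α g x)‖ ≤ ε := by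
  classical
  have hcard : (0 : ℝ) < Fintype.card G := by exact_mod_cast Fintype.card_pos
  set z : A → G → A := fun x g => (β g * (α g)⁻¹) x with hz
  set K : Set A := F ∪ F' ∪ ⋃ g, α g '' F' with hK
  have hKfin : K.Finite := (hF.union hF').union (Set.finite_iUnion fun g => hF'.image _)
  have hη : 0 < ε / (8 * Fintype.card G) := by positivity
  have hw : ∀ g, ∃ w : unitary (Unitization ℂ A), ∀ x ∈ K,
      ‖innerAut A w x - z x g‖ ≤ ε / (8 * Fintype.card G) := fun g => by
    obtain ⟨_, ⟨w, rfl⟩, hw⟩ := hαβ g hKfin.toFinset _ hη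
    exact ⟨w, fun x hx => hw x (hKfin.mem_toFinset.2 hx)⟩
  choose w hw using hw
  obtain ⟨v, hv⟩ := h.exists_unitary_tendsto w
  have hsmall : ∀ {f : ι → A}, Tendsto f l (𝓝 0) → ∀ {η : ℝ}, 0 < η → ∀ᶠ n in l, ‖f n‖ ≤ η :=
    fun hf _ hη => (tendsto_zero_iff_norm_tendsto_zero.1 hf).eventually_le_const hη
  have e1 : ∀ᶠ n in l, ∀ x ∈ K, ‖innerAut A (v n) x -
      weightedSum (a n) (fun g => innerAut A (w g) x)‖ ≤ ε / 8 :=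
    (hKfin.eventually_all).2 fun x _ => hsmall (hv x) (by positivity)
  have e2 : ∀ᶠ n in l, ∀ x ∈ F, ‖weightedSum (a n) (fun _ => x) - x‖ ≤ ε / 4 :=
    (hF.eventually_all).2 fun x _ => hsmall (h.tendsto_const x) (by positivity)
  have e3 : ∀ᶠ n in l, ∀ g, ∀ x ∈ F', ‖β g (weightedSum (a n) (z x)) -
      weightedSum (a n) (fun k => β g (z x (g⁻¹ * k)))‖ ≤ ε / 4 :=
    eventually_all.2 fun g => (hF'.eventually_all).2 fun x _ =>
      hsmall (h.tendsto_equivariant g (z x)) (by positivity)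
  obtain ⟨n, h1, h2, h3⟩ := (e1.and (e2.and e3)).exists
  have hle : ∀ {x y : G → A} {η : ℝ}, (∀ g, ‖x g - y g‖ ≤ η) →
      ‖weightedSum (a n) x - weightedSum (a n) y‖ ≤ Fintype.card G * η := fun {x y η} hxy => by
    rw [← weightedSum_sub]
    refine (norm_weightedSum_le (h.norm_le n) _).trans ?_
    refine (Finset.sum_le_card_nsmul _ _ η fun g _ => hxy g).trans ?_
    rw [nsmul_eq_mul, Finset.card_univ]
  have h4 : ∀ x ∈ K, ‖innerAut A (v n) x - weightedSum (a n) (z x)‖ ≤ ε / 4 := fun x hx => by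
    have h5 := hle (fun g => hw g x hx)
    have h6 : (Fintype.card G : ℝ) * (ε / (8 * Fintype.card G)) = ε / 8 := by
      field_simp
    rw [h6] at h5
    linarith [norm_sub_le_norm_sub_add_norm_sub (innerAut A (v n) x)
      (weightedSum (a n) (fun g => innerAut A (w g) x)) (weightedSum (a n) (z x)), h1 x hx]
  refine ⟨_, ⟨v n, rfl⟩, fun x hx => ?_, fun g x hx => ?_⟩
  · have h5 : ‖weightedSum (a n) (z x) - weightedSum (a n) (fun _ => x)‖ ≤ Fintype.card G * δ := by
      refine hle fun g => ?_
      have := hδ g⁻¹ x hx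
      rwa [map_inv β, ← StarAlgEquiv.norm_apply_sub_apply (β g), StarAlgEquiv.apply_inv_apply,
        map_inv α] at this
    have h6 := h4 x (Or.inl (Or.inl hx))
    linarith [norm_sub_le_norm_sub_add_norm_sub (innerAut A (v n) x)
      (weightedSum (a n) (z x)) x, norm_sub_le_norm_sub_add_norm_sub (weightedSum (a n) (z x))
      (weightedSum (a n) (fun _ => x)) x, h2 x hx]
  · have h5 : (fun k => β g (z x (g⁻¹ * k))) = z (α g x) := by
      ext k
      simp only [hz, ← StarAlgEquiv.mul_apply, map_mul, map_inv]
      congr 1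
      group
    have h6 := h3 g x hx
    rw [h5] at h6
    have h7 := h4 x (Or.inl (Or.inr hx))
    rw [← StarAlgEquiv.norm_apply_sub_apply (β g)] at h7
    have h8 := h4 (α g x) (Or.inr (Set.mem_iUnion.2 ⟨g, x, hx, rfl⟩))
    rw [norm_sub_rev] at h8
    linarith [norm_sub_le_norm_sub_add_norm_sub (β g (innerAut A (v n) x))
      (β g (weightedSum (a n) (z x))) (innerAut A (v n) (α g x)),
      norm_sub_le_norm_sub_add_norm_sub (β g (weightedSum (a n) (z x)))
      (weightedSum (a n) (z (α g x))) (innerAut A (v n) (α g x))]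

/-- One half-step of the intertwining: correct `ψ` by an inner automorphism `i` so that the
conjugates of `α` by `φ` and of `β` by `i * ψ` become close. -/
theorem IsRokhlinNet.exists_inner_conj_close (h : IsRokhlinNet β l a)
    (hαβ : ∀ g, β g * (α g)⁻¹ ∈ approxInner A) {φ ψ : A ≃⋆ₐ[ℂ] A}
    (hφ : φ ∈ (innerAut A).range) (hψ : ψ ∈ (innerAut A).range) {F : Set A} (hF : F.Finite)
    {F' : Set A} (hF' : F'.Finite) {δ ε : ℝ} (hε : 0 < ε)
    (hδ : ∀ g, ∀ x ∈ F, ‖(φ * α g * φ⁻¹) x - (ψ * β g * ψ⁻¹) x‖ ≤ δ) :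
    ∃ i ∈ (innerAut A).range, (∀ x ∈ F, ‖i x - x‖ ≤ Fintype.card G * δ + ε) ∧
      ∀ g, ∀ x ∈ F', ‖(φ * α g * φ⁻¹) x - ((i * ψ) * β g * (i * ψ)⁻¹) x‖ ≤ ε := by
  have hmem : ∀ g, ((MulAut.conj ψ).toMonoidHom.comp β) g *
      (((MulAut.conj φ).toMonoidHom.comp α) g)⁻¹ ∈ approxInner A := fun g => by
    have hφ1 := (QuotientGroup.eq_one_iff φ).2 (range_innerAut_le_approxInner hφ)
    have hψ1 := (QuotientGroup.eq_one_iff ψ).2 (range_innerAut_le_approxInner hψ)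
    have h1 := (QuotientGroup.eq_one_iff _).2 (hαβ g)
    rw [QuotientGroup.mk_mul, QuotientGroup.mk_inv] at h1
    rw [← QuotientGroup.eq_one_iff]
    simp [hφ1, hψ1, h1]
  obtain ⟨i, hi, hiF, hiF'⟩ := (h.conj ψ).exists_inner_approx_equivariant hmem hF hF' hε hδ
  refine ⟨i⁻¹, inv_mem hi, fun x hx => ?_, fun g x hx => ?_⟩
  · rw [StarAlgEquiv.norm_inv_apply_sub, norm_sub_rev]
    exact hiF x hx
  · have := hiF' g x hx
    rw [← StarAlgEquiv.norm_inv_apply_sub, norm_sub_rev] at this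
    simpa [mul_assoc] using this

end Intertwining

section Limits

variable {A : Type*} [NonUnitalCStarAlgebra A]

theorem StarAlgEquiv.tendsto_apply {ι : Type*} {l : Filter ι} {f : ι → A ≃⋆ₐ[ℂ] A} {y : ι → A}
    {x z : A} (hf : Tendsto (fun n => f n x) l (𝓝 z)) (hy : Tendsto y l (𝓝 x)) :
    Tendsto (fun n => f n (y n)) l (𝓝 z) := by
  have h1 : Tendsto (fun n => f n (y n) - f n x) l (𝓝 0) := by
    rw [tendsto_zero_iff_norm_tendsto_zero]
    simp only [StarAlgEquiv.norm_apply_sub_apply]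
    rw [← tendsto_zero_iff_norm_tendsto_zero]
    simpa using hy.sub_const x
  simpa using h1.add hf

/-- A sequence of automorphisms converging pointwise together with the inverses converges to an
automorphism. -/
theorem StarAlgEquiv.exists_tendsto {f : ℕ → A ≃⋆ₐ[ℂ] A}
    (hf : ∀ x, ∃ y, Tendsto (fun n => f n x) atTop (𝓝 y))
    (hf' : ∀ x, ∃ y, Tendsto (fun n => (f n)⁻¹ x) atTop (𝓝 y)) :
    ∃ φ : A ≃⋆ₐ[ℂ] A, (∀ x, Tendsto (fun n => f n x) atTop (𝓝 (φ x))) ∧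
      ∀ x, Tendsto (fun n => (f n)⁻¹ x) atTop (𝓝 (φ⁻¹ x)) := by
  choose F hF using hf
  choose F' hF' using hf'
  let φ : A ≃⋆ₐ[ℂ] A :=
    { toFun := F
      invFun := F'
      left_inv := fun x => tendsto_nhds_unique (StarAlgEquiv.tendsto_apply (hF' (F x)) (hF x))
        (by simp)
      right_inv := fun x => tendsto_nhds_unique (StarAlgEquiv.tendsto_apply (hF (F' x)) (hF' x))
        (by simp)
      map_mul' := fun x y => tendsto_nhds_unique (hF (x * y)) (by
        simpa only [map_mul] using (hF x).mul (hF y))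
      map_add' := fun x y => tendsto_nhds_unique (hF (x + y)) (by
        simpa only [map_add] using (hF x).add (hF y))
      map_star' := fun x => tendsto_nhds_unique (hF (star x)) (by
        simpa only [map_star] using (hF x).star)
      map_smul' := fun c x => tendsto_nhds_unique (hF (c • x)) (by
        simpa only [map_smul] using (hF x).const_smul c) }
  exact ⟨φ, hF, hF'⟩

theorem StarAlgEquiv.exists_tendsto_of_dense {f : ℕ → A ≃⋆ₐ[ℂ] A} {x : ℕ → A}
    (hx : DenseRange x) (hf : ∀ k, ∃ y, Tendsto (fun n => f n (x k)) atTop (𝓝 y)) (z : A) :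
    ∃ y, Tendsto (fun n => f n z) atTop (𝓝 y) := by
  refine cauchySeq_tendsto_of_complete (Metric.cauchySeq_iff.2 fun ε hε => ?_)
  obtain ⟨k, hk⟩ := hx.exists_dist_lt z (by positivity : 0 < ε / 3)
  obtain ⟨y, hy⟩ := hf k
  obtain ⟨N, hN⟩ := Metric.cauchySeq_iff.1 hy.cauchySeq (ε / 3) (by positivity)
  refine ⟨N, fun m hm n hn => ?_⟩
  have h1 : dist (f m z) (f m (x k)) < ε / 3 := by rwa [(StarAlgEquiv.isometry (f m)).dist_eq]
  have h2 : dist (f n (x k)) (f n z) < ε / 3 := by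
    rwa [(StarAlgEquiv.isometry (f n)).dist_eq, dist_comm]
  linarith [dist_triangle4 (f m z) (f m (x k)) (f n (x k)) (f n z), hN m hm n hn]

theorem exists_tendsto_of_eventually_norm_sub_le {E : Type*} [NormedAddCommGroup E]
    [CompleteSpace E] {y : ℕ → E} {C : ℝ} {k : ℕ}
    (h : ∀ n, k < n → ‖y (n + 1) - y n‖ ≤ C * (1 / 2) ^ n) : ∃ z, Tendsto y atTop (𝓝 z) := by
  refine cauchySeq_tendsto_of_complete (cauchySeq_of_summable_dist ?_)
  refine Summable.of_norm_bounded_eventually_nat (summable_geometric_two.mul_left C) ?_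
  filter_upwards [eventually_gt_atTop k] with n hn
  rw [Real.norm_of_nonneg dist_nonneg, dist_comm, dist_eq_norm]
  exact h n hn

/-- An infinite left product of automorphisms whose factors are summably close to the identity on
a dense sequence and on its images converges to an automorphism. -/
theorem StarAlgEquiv.exists_tendsto_of_mul {f i : ℕ → A ≃⋆ₐ[ℂ] A} {x : ℕ → A} (hx : DenseRange x)
    (hfi : ∀ n, f (n + 1) = i n * f n) {C : ℝ}
    (h : ∀ k n, k < n → ‖i n (x k) - x k‖ ≤ C * (1 / 2) ^ n)
    (h' : ∀ k n, k < n → ‖i n (f n (x k)) - f n (x k)‖ ≤ C * (1 / 2) ^ n) :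
    ∃ φ : A ≃⋆ₐ[ℂ] A, (∀ x, Tendsto (fun n => f n x) atTop (𝓝 (φ x))) ∧
      ∀ x, Tendsto (fun n => (f n)⁻¹ x) atTop (𝓝 (φ⁻¹ x)) := by
  refine StarAlgEquiv.exists_tendsto (StarAlgEquiv.exists_tendsto_of_dense hx fun k => ?_)
    (StarAlgEquiv.exists_tendsto_of_dense hx fun k => ?_)
  · refine exists_tendsto_of_eventually_norm_sub_le (C := C) (k := k) fun n hn => ?_
    rw [hfi]
    exact h' k n hn
  · refine exists_tendsto_of_eventually_norm_sub_le (C := C) (k := k) fun n hn => ?_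
    rw [hfi, mul_inv_rev, StarAlgEquiv.mul_apply, StarAlgEquiv.norm_apply_sub_apply,
      StarAlgEquiv.norm_inv_apply_sub, norm_sub_rev]
    exact h k n hn

end Limits

set_option maxHeartbeats 1000000 in
/-- Two-sided intertwining: Rokhlin actions agreeing modulo approximately inner automorphisms are
conjugate by limits of inner automorphisms. -/
theorem IsRokhlinNet.exists_limits_conj_eq {A : Type*} [NonUnitalCStarAlgebra A]
    [TopologicalSpace.SeparableSpace A] {G ι κ : Type*} [Group G] [Fintype G]
    {l : Filter ι} [l.NeBot] {m : Filter κ} [m.NeBot] {a : ι → G → A} {b : κ → G → A}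
    {α β : G →* (A ≃⋆ₐ[ℂ] A)} (hα : IsRokhlinNet α l a) (hβ : IsRokhlinNet β m b)
    (hαβ : ∀ g, β g * (α g)⁻¹ ∈ approxInner A) :
    ∃ (f p : ℕ → A ≃⋆ₐ[ℂ] A) (φ ψ : A ≃⋆ₐ[ℂ] A),
      (∀ n, f n ∈ (innerAut A).range) ∧ (∀ n, p n ∈ (innerAut A).range) ∧
      (∀ x, Tendsto (fun n => (f n)⁻¹ x) atTop (𝓝 (φ⁻¹ x))) ∧
      (∀ x, Tendsto (fun n => p n x) atTop (𝓝 (ψ x))) ∧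
      ∀ g, φ * α g * φ⁻¹ = ψ * β g * ψ⁻¹ := by
  have hβα : ∀ g, α g * (β g)⁻¹ ∈ approxInner A := fun g => by
    simpa using inv_mem (hαβ g)
  set x : ℕ → A := TopologicalSpace.denseSeq A with hxdef
  have hx : DenseRange x := TopologicalSpace.denseRange_denseSeq A
  set C : ℝ := Fintype.card G + 1 with hC
  let P : ℕ → (A ≃⋆ₐ[ℂ] A) × (A ≃⋆ₐ[ℂ] A) → Prop := fun n s =>
    s.1 ∈ (innerAut A).range ∧ s.2 ∈ (innerAut A).range ∧ ∀ g, ∀ k < n,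
      ‖(s.1 * α g * s.1⁻¹) (x k) - (s.2 * β g * s.2⁻¹) (x k)‖ ≤ (1 / 2) ^ n ∧
      ‖(s.1 * α g * s.1⁻¹) (s.2 (x k)) - (s.2 * β g * s.2⁻¹) (s.2 (x k))‖ ≤ (1 / 2) ^ n
  let Q : ℕ → (A ≃⋆ₐ[ℂ] A) × (A ≃⋆ₐ[ℂ] A) → (A ≃⋆ₐ[ℂ] A) × (A ≃⋆ₐ[ℂ] A) → Prop :=
    fun n s t => ∃ j i, t.1 = j * s.1 ∧ t.2 = i * s.2 ∧ ∀ k < n,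
      (‖j (x k) - x k‖ ≤ C * (1 / 2) ^ n ∧ ‖j (s.1 (x k)) - s.1 (x k)‖ ≤ C * (1 / 2) ^ n) ∧
      (‖i (x k) - x k‖ ≤ C * (1 / 2) ^ n ∧ ‖i (s.2 (x k)) - s.2 (x k)‖ ≤ C * (1 / 2) ^ n)
  have step : ∀ n s, P n s → ∃ t, P (n + 1) t ∧ Q n s t := by
    rintro n ⟨φ, ψ⟩ ⟨hφ, hψ, hclose⟩
    have hpos : ∀ n : ℕ, (0 : ℝ) < (1 / 2) ^ n := fun n => by positivity
    have hfin : ∀ (θ : A ≃⋆ₐ[ℂ] A) (n : ℕ),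
        (x '' Set.Iio n ∪ (fun k => θ (x k)) '' Set.Iio n).Finite := fun θ n =>
      ((Set.finite_Iio n).image _).union ((Set.finite_Iio n).image _)
    have hforall : ∀ (θ : A ≃⋆ₐ[ℂ] A) (n : ℕ) (R : A → Prop),
        (∀ y ∈ x '' Set.Iio n ∪ (fun k => θ (x k)) '' Set.Iio n, R y) ↔
          ∀ k < n, R (x k) ∧ R (θ (x k)) := fun θ n R => by
      simp only [Set.mem_union, or_imp, forall_and, Set.forall_mem_image, Set.mem_Iio]
    have hCn : C * (1 / 2) ^ n = Fintype.card G * (1 / 2) ^ n + (1 / 2) ^ n := by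
      rw [hC]; ring
    obtain ⟨i, hi, hi1, hi2⟩ := hβ.exists_inner_conj_close hαβ hφ hψ (hfin ψ n) (hfin φ n)
      (hpos n) (δ := (1 / 2) ^ n) fun g => (hforall ψ n _).2 (hclose g)
    obtain ⟨j, hj, hj1, hj2⟩ := hα.exists_inner_conj_close hβα (mul_mem hi hψ) hφ (hfin φ n)
      (hfin (i * ψ) (n + 1)) (hpos (n + 1)) (δ := (1 / 2) ^ n) fun g y hy => by
        rw [norm_sub_rev]
        exact hi2 g y hy
    rw [← hCn] at hi1
    have hj1' := fun y hy => (hj1 y hy).trans (show _ ≤ C * (1 / 2) ^ n by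
      rw [hCn]
      exact add_le_add_right (pow_le_pow_of_le_one (by norm_num) (by norm_num) n.le_succ) _)
    refine ⟨(j * φ, i * ψ), ⟨mul_mem hj hφ, mul_mem hi hψ, fun g => ?_⟩, j, i, rfl, rfl,
      fun k hk => ⟨(hforall φ n _).1 hj1' k hk, (hforall ψ n _).1 hi1 k hk⟩⟩
    refine (hforall (i * ψ) (n + 1) (fun y => ‖((j * φ) * α g * (j * φ)⁻¹) y -
      ((i * ψ) * β g * (i * ψ)⁻¹) y‖ ≤ (1 / 2) ^ (n + 1))).1 fun y hy => ?_
    rw [norm_sub_rev]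
    exact hj2 g y hy
  choose! next hnextP hnextQ using step
  let s : ℕ → (A ≃⋆ₐ[ℂ] A) × (A ≃⋆ₐ[ℂ] A) := fun n => Nat.rec (1, 1) next n
  have hsP : ∀ n, P n (s n) := fun n => by
    induction n with
    | zero => exact ⟨one_mem _, one_mem _, fun _ _ hk => absurd hk (Nat.not_lt_zero _)⟩
    | succ n ih => exact hnextP n _ ih
  have hsQ : ∀ n, Q n (s n) (s (n + 1)) := fun n => hnextQ n _ (hsP n)
  choose j i hsj hsi hji using hsQ
  obtain ⟨φ, hφ, hφ'⟩ := StarAlgEquiv.exists_tendsto_of_mul (f := fun n => (s n).1) hx hsj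
    (fun k n hk => (hji n k hk).1.1) (fun k n hk => (hji n k hk).1.2)
  obtain ⟨ψ, hψ, hψ'⟩ := StarAlgEquiv.exists_tendsto_of_mul (f := fun n => (s n).2) hx hsi
    (fun k n hk => (hji n k hk).2.1) (fun k n hk => (hji n k hk).2.2)
  refine ⟨fun n => (s n).1, fun n => (s n).2, φ, ψ, fun n => (hsP n).1, fun n => (hsP n).2.1, hφ',
    hψ, fun g => ?_⟩
  have hconj : ∀ {f : ℕ → A ≃⋆ₐ[ℂ] A} {θ : A ≃⋆ₐ[ℂ] A} (γ : A ≃⋆ₐ[ℂ] A),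
      (∀ x, Tendsto (fun n => f n x) atTop (𝓝 (θ x))) →
      (∀ x, Tendsto (fun n => (f n)⁻¹ x) atTop (𝓝 (θ⁻¹ x))) → ∀ y,
      Tendsto (fun n => (f n * γ * (f n)⁻¹) y) atTop (𝓝 ((θ * γ * θ⁻¹) y)) :=
    fun {f θ} γ hf hf' y => StarAlgEquiv.tendsto_apply (f := f) (hf _)
      (((StarAlgEquiv.isometry γ).continuous.tendsto _).comp (hf' y))
  refine DFunLike.coe_injective (hx.equalizer (StarAlgEquiv.isometry _).continuous
    (StarAlgEquiv.isometry _).continuous (funext fun k => ?_))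
  have h1 := (hconj (α g) hφ hφ' (x k)).sub (hconj (β g) hψ hψ' (x k))
  have h2 : Tendsto (fun n => ((s n).1 * α g * (s n).1⁻¹) (x k) -
      ((s n).2 * β g * (s n).2⁻¹) (x k)) atTop (𝓝 0) := by
    refine squeeze_zero_norm' ?_
      (tendsto_pow_atTop_nhds_zero_of_lt_one (r := (1 / 2 : ℝ)) (by norm_num) (by norm_num))
    filter_upwards [eventually_gt_atTop k] with n hn
    exact ((hsP n).2.2 g k hn).1
  exact sub_eq_zero.1 (tendsto_nhds_unique h1 h2)

/-- Two Rokhlin actions of a finite group on a separable C⋆-algebra which are pointwise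
approximately unitarily equivalent are conjugate by an approximately inner automorphism. -/
theorem rokhlin_pointwise_approxUnitarilyEquiv_conjugate
    {G A : Type*} [Group G] [Fintype G] [NonUnitalCStarAlgebra A]
    [PartialOrder A] [StarOrderedRing A] [TopologicalSpace.SeparableSpace A]
    (α₀ α₁ : G → A ≃⋆ₐ[ℂ] A)
    (hα₀ : ∀ g h : G, ∀ a : A, α₀ (g * h) a = α₀ g (α₀ h a))
    (hα₁ : ∀ g h : G, ∀ a : A, α₁ (g * h) a = α₁ g (α₁ h a))
    (hRok₀ : RokhlinProperty α₀) (hRok₁ : RokhlinProperty α₁)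
    (hue : ∀ g : G, ApproxUnitarilyEquiv (⇑(α₀ g)) (⇑(α₁ g))) :
    ∃ φ : A ≃⋆ₐ[ℂ] A, ApproxUnitarilyEquiv (⇑φ) (id : A → A) ∧
      ∀ (g : G) (a : A), α₁ g (φ a) = φ (α₀ g a) := by
  classical
  obtain ⟨a, ha⟩ := RokhlinProperty.exists_isRokhlinNet
    (β := MonoidHom.mk' α₀ fun g h => StarAlgEquiv.ext (hα₀ g h)) hRok₀
  obtain ⟨b, hb⟩ := RokhlinProperty.exists_isRokhlinNet
    (β := MonoidHom.mk' α₁ fun g h => StarAlgEquiv.ext (hα₁ g h)) hRok₁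
  obtain ⟨f, p, φ, ψ, hf, hp, hφ, hψ, hconj⟩ :=
    ha.exists_limits_conj_eq hb fun g => (hue g).mul_inv_mem_approxInner
  choose u hu using fun n => mul_mem (inv_mem (hf n)) (hp n)
  refine ⟨ψ⁻¹ * φ, ⟨u, fun x => ?_⟩, fun g x => ?_⟩
  · have h1 : Tendsto (fun n => innerAut A (u n) ((ψ⁻¹ * φ) x)) atTop (𝓝 x) := by
      simp only [hu]
      have := StarAlgEquiv.tendsto_apply (hφ (φ x)) (by simpa using hψ ((ψ⁻¹ * φ) x))
      simpa using this
    have h2 := tendsto_iff_norm_sub_tendsto_zero.1 h1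
    refine h2.congr fun n => ?_
    rw [← inr_innerAut, id, ← Unitization.inr_sub, norm_inr]
  · have h1 : φ * α₀ g * φ⁻¹ = ψ * α₁ g * ψ⁻¹ := hconj g
    have h2 : α₁ g * (ψ⁻¹ * φ) = ψ⁻¹ * φ * α₀ g := by
      rw [mul_inv_eq_iff_eq_mul] at h1
      rw [mul_assoc ψ⁻¹, h1]
      group
    exact DFunLike.congr_fun h2 x
end
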